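/- Let ν > 3, |ε₀| sufficiently small, λ(t) := t^{-1-ν} exp(−ε₀ sin(log t)), μ(t) := tλ(t), and write R := rλ(t). Then there exist t₀ ∈ (0,1/2), a function u₂ ∈ C²({(t,r) : 0 < t < t₀, 0 ≤ r ≤ t}), and constants C_{k,j} such that: (i) |u₂(t,r) − λ(t)^{1/2} W(R)| ≤ C λ(t)^{1/2} μ(t)^{-2} R on 0 < t < t₀, 0 < r < t, and the error e₂ := ∂_t²u₂ − ∂_r²u₂ − (2/r)∂_r u₂ − u₂⁵ satisfies |t² λ(t)^{-1/2} e₂(t,r)| ≤ C μ(t)^{-2} log(R+2)/(R+1); (ii) for 0 < t < t₀ and 0 < r < t/2 and all integers k, j ≥ 0, |∂_t^k ∂_r^j (u₂(t,r) − λ(t)^{1/2}W(R))| ≤ C_{k,j} t^{-k} r^{-j} λ(t)^{1/2} μ(t)^{-2} R and |∂_t^k ∂_r^j (t² λ(t)^{-1/2} e₂(t,r))| ≤ C_{k,j} t^{-k} r^{-j} μ(t)^{-2} log(R+2)/(R+1); moreover the latter two bounds hold on the whole region 0 < r < t whenever k + j ≤ 2. -/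

import Mathlib

noncomputable section

/-- The ground state `W(R) = (1+R²/3)^{-1/2}`. -/
def W (R : ℝ) : ℝ := (1 + R ^ 2 / 3) ^ (-(1 : ℝ) / 2)

/-- The scaling factor `λ(t) = t^{-1-ν} exp(−ε₀ sin(log t))`. -/
def lam (ν ε₀ t : ℝ) : ℝ := t ^ (-1 - ν) * Real.exp (-ε₀ * Real.sin (Real.log t))

/-- `μ(t) = t λ(t)`. -/
def mu (ν ε₀ t : ℝ) : ℝ := t * lam ν ε₀ t

/-- Mixed partial derivative `∂_t^k ∂_r^j u (t,r)`. -/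
def pd (k j : ℕ) (u : ℝ → ℝ → ℝ) (t r : ℝ) : ℝ :=
  iteratedDeriv k (fun t' => iteratedDeriv j (fun r' => u t' r') r) t

/-- The error `e₂ = ∂_t²u − ∂_r²u − (2/r)∂_r u − u⁵` of an approximate solution. -/
def err (u : ℝ → ℝ → ℝ) (t r : ℝ) : ℝ :=
  pd 2 0 u t r - pd 0 2 u t r - 2 / r * pd 0 1 u t r - (u t r) ^ 5

/-- The difference `u₂ − λ^{1/2} W(rλ)` as a two-variable function. -/
def bulkDiff (ν ε₀ : ℝ) (u : ℝ → ℝ → ℝ) : ℝ → ℝ → ℝ :=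
  fun t r => u t r - (lam ν ε₀ t) ^ ((1 : ℝ) / 2) * W (r * lam ν ε₀ t)

/-- The renormalized error `t² λ(t)^{-1/2} e₂(t,r)` as a two-variable function. -/
def renErr (ν ε₀ : ℝ) (u : ℝ → ℝ → ℝ) : ℝ → ℝ → ℝ :=
  fun t r => t ^ 2 * (lam ν ε₀ t) ^ (-(1 : ℝ) / 2) * err u t r

/-- Symbols of order `n` with weight `g` on `Ω`: the function and its iterated `t∂_t`, `r∂_r`
derivatives up to total order `n` are bounded by multiples of `g`. -/
def Symb (Ω : Set (ℝ × ℝ)) (g : ℝ → ℝ → ℝ) : ℕ → (ℝ → ℝ → ℝ) → Prop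
  | 0, F => ∃ C : ℝ, ∀ t r, (t, r) ∈ Ω → |F t r| ≤ C * g t r
  | n + 1, F => (∃ C : ℝ, ∀ t r, (t, r) ∈ Ω → |F t r| ≤ C * g t r) ∧
      ∃ Ft Fr : ℝ → ℝ → ℝ,
        (∀ t r, (t, r) ∈ Ω → HasDerivAt (fun s => F s r) (Ft t r / t) t ∧
          HasDerivAt (F t) (Fr t r / r) r) ∧ Symb Ω g n Ft ∧ Symb Ω g n Fr

/-- The region `t, r > 0`. -/
def quadrant : Set (ℝ × ℝ) := {p | 0 < p.1 ∧ 0 < p.2}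

namespace Symb

variable {Ω Ω' : Set (ℝ × ℝ)} {g g' g₁ g₂ : ℝ → ℝ → ℝ} {F G : ℝ → ℝ → ℝ} {n m : ℕ}

theorem bound (h : Symb Ω g n F) : ∃ C : ℝ, ∀ t r, (t, r) ∈ Ω → |F t r| ≤ C * g t r := by
  cases n with
  | zero => exact h
  | succ n => exact h.1

theorem bound_nonneg (hg : ∀ t r, (t, r) ∈ Ω → 0 ≤ g t r) (h : Symb Ω g n F) :
    ∃ C : ℝ, 0 ≤ C ∧ ∀ t r, (t, r) ∈ Ω → |F t r| ≤ C * g t r := by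
  obtain ⟨C, hC⟩ := h.bound
  exact ⟨|C|, abs_nonneg _, fun t r hx => (hC t r hx).trans
    (mul_le_mul_of_nonneg_right (le_abs_self C) (hg t r hx))⟩

theorem of_succ (h : Symb Ω g (n + 1) F) : Symb Ω g n F := by
  induction n generalizing F with
  | zero => exact h.1
  | succ n ih =>
    obtain ⟨hb, Ft, Fr, hd, h1, h2⟩ := h
    exact ⟨hb, Ft, Fr, hd, ih h1, ih h2⟩

theorem of_le (hmn : m ≤ n) (h : Symb Ω g n F) : Symb Ω g m F := by
  induction n, hmn using Nat.le_induction with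
  | base => exact h
  | succ k _ ih => exact ih h.of_succ

theorem mono_set (hs : Ω' ⊆ Ω) (h : Symb Ω g n F) : Symb Ω' g n F := by
  induction n generalizing F with
  | zero => exact h.imp fun C hC t r hx => hC t r (hs hx)
  | succ n ih =>
    obtain ⟨hb, Ft, Fr, hd, h1, h2⟩ := h
    exact ⟨hb.imp fun C hC t r hx => hC t r (hs hx), Ft, Fr, fun t r hx => hd t r (hs hx),
      ih h1, ih h2⟩

theorem mono_weight (hg : ∀ t r, (t, r) ∈ Ω → 0 ≤ g t r)
    (hgg : ∃ C : ℝ, ∀ t r, (t, r) ∈ Ω → g t r ≤ C * g' t r) (h : Symb Ω g n F) :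
    Symb Ω g' n F := by
  have key : ∀ F : ℝ → ℝ → ℝ, (∃ C : ℝ, ∀ t r, (t, r) ∈ Ω → |F t r| ≤ C * g t r) →
      ∃ C : ℝ, ∀ t r, (t, r) ∈ Ω → |F t r| ≤ C * g' t r := by
    rintro F ⟨C, hC⟩
    obtain ⟨K, hK⟩ := hgg
    refine ⟨|C| * K, fun t r hx => (hC t r hx).trans ?_⟩
    calc C * g t r ≤ |C| * g t r := mul_le_mul_of_nonneg_right (le_abs_self C) (hg t r hx)
      _ ≤ |C| * (K * g' t r) := mul_le_mul_of_nonneg_left (hK t r hx) (abs_nonneg _)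
      _ = |C| * K * g' t r := by ring
  induction n generalizing F with
  | zero => exact key F h
  | succ n ih =>
    obtain ⟨hb, Ft, Fr, hd, h1, h2⟩ := h
    exact ⟨key F hb, Ft, Fr, hd, ih h1, ih h2⟩

theorem congr_weight (hgg : ∀ t r, (t, r) ∈ Ω → g t r = g' t r) (h : Symb Ω g n F) :
    Symb Ω g' n F := by
  have key : ∀ F : ℝ → ℝ → ℝ, (∃ C : ℝ, ∀ t r, (t, r) ∈ Ω → |F t r| ≤ C * g t r) →
      ∃ C : ℝ, ∀ t r, (t, r) ∈ Ω → |F t r| ≤ C * g' t r := by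
    rintro F ⟨C, hC⟩
    exact ⟨C, fun t r hx => hgg t r hx ▸ hC t r hx⟩
  induction n generalizing F with
  | zero => exact key F h
  | succ n ih =>
    obtain ⟨hb, Ft, Fr, hd, h1, h2⟩ := h
    exact ⟨key F hb, Ft, Fr, hd, ih h1, ih h2⟩

theorem add (hF : Symb Ω g n F) (hG : Symb Ω g n G) :
    Symb Ω g n (fun t r => F t r + G t r) := by
  have key : ∀ F G : ℝ → ℝ → ℝ, (∃ C : ℝ, ∀ t r, (t, r) ∈ Ω → |F t r| ≤ C * g t r) →
      (∃ C : ℝ, ∀ t r, (t, r) ∈ Ω → |G t r| ≤ C * g t r) →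
      ∃ C : ℝ, ∀ t r, (t, r) ∈ Ω → |F t r + G t r| ≤ C * g t r := by
    rintro F G ⟨C, hC⟩ ⟨D, hD⟩
    refine ⟨C + D, fun t r hx => (abs_add_le _ _).trans ?_⟩
    linarith [hC t r hx, hD t r hx]
  induction n generalizing F G with
  | zero => exact key F G hF hG
  | succ n ih =>
    obtain ⟨hb, Ft, Fr, hd, h1, h2⟩ := hF
    obtain ⟨hb', Gt, Gr, hd', h1', h2'⟩ := hG
    refine ⟨key F G hb hb', _, _, fun t r hx => ⟨?_, ?_⟩, ih h1 h1', ih h2 h2'⟩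
    · exact ((hd t r hx).1.add (hd' t r hx).1).congr_deriv (by ring)
    · exact ((hd t r hx).2.add (hd' t r hx).2).congr_deriv (by ring)

theorem mul (hF : Symb Ω g₁ n F) (hG : Symb Ω g₂ n G) :
    Symb Ω (fun t r => g₁ t r * g₂ t r) n (fun t r => F t r * G t r) := by
  have key : ∀ F G : ℝ → ℝ → ℝ, (∃ C : ℝ, ∀ t r, (t, r) ∈ Ω → |F t r| ≤ C * g₁ t r) →
      (∃ C : ℝ, ∀ t r, (t, r) ∈ Ω → |G t r| ≤ C * g₂ t r) →
      ∃ C : ℝ, ∀ t r, (t, r) ∈ Ω → |F t r * G t r| ≤ C * (g₁ t r * g₂ t r) := by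
    rintro F G ⟨C, hC⟩ ⟨D, hD⟩
    refine ⟨C * D, fun t r hx => ?_⟩
    rw [abs_mul]
    calc |F t r| * |G t r| ≤ (C * g₁ t r) * (D * g₂ t r) :=
          mul_le_mul (hC t r hx) (hD t r hx) (abs_nonneg _) ((abs_nonneg _).trans (hC t r hx))
      _ = _ := by ring
  induction n generalizing F G with
  | zero => exact key F G hF hG
  | succ n ih =>
    have hF' := hF.of_succ
    have hG' := hG.of_succ
    obtain ⟨hb, Ft, Fr, hd, h1, h2⟩ := hF
    obtain ⟨hb', Gt, Gr, hd', h1', h2'⟩ := hG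
    refine ⟨key F G hb hb', _, _, fun t r hx => ⟨?_, ?_⟩, (ih h1 hG').add (ih hF' h1'),
      (ih h2 hG').add (ih hF' h2')⟩
    · exact ((hd t r hx).1.mul (hd' t r hx).1).congr_deriv (by ring)
    · exact ((hd t r hx).2.mul (hd' t r hx).2).congr_deriv (by ring)

theorem const (c : ℝ) : Symb Ω (fun _ _ => 1) n (fun _ _ => c) := by
  induction n generalizing c with
  | zero => exact ⟨|c|, fun _ _ _ => by simp⟩
  | succ n ih =>
    exact ⟨⟨|c|, fun _ _ _ => by simp⟩, fun _ _ => 0, fun _ _ => 0,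
      fun t r _ => ⟨by simpa using hasDerivAt_const t c, by simpa using hasDerivAt_const r c⟩,
      ih 0, ih 0⟩

theorem const_mul (c : ℝ) (hF : Symb Ω g n F) : Symb Ω g n (fun t r => c * F t r) :=
  ((const c).mul hF).congr_weight fun _ _ _ => one_mul _

theorem neg (hF : Symb Ω g n F) : Symb Ω g n (fun t r => - F t r) := by
  simpa using hF.const_mul (-1)

theorem sub (hF : Symb Ω g n F) (hG : Symb Ω g n G) :
    Symb Ω g n (fun t r => F t r - G t r) := by
  simpa [sub_eq_add_neg] using hF.add hG.neg

theorem pow (hF : Symb Ω g n F) (k : ℕ) :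
    Symb Ω (fun t r => g t r ^ k) n (fun t r => F t r ^ k) := by
  induction k with
  | zero => simpa using const (Ω := Ω) (n := n) 1
  | succ k ih => simpa [pow_succ] using ih.mul hF

theorem congr (ho : IsOpen Ω) (hFG : ∀ t r, (t, r) ∈ Ω → F t r = G t r) (hF : Symb Ω g n F) :
    Symb Ω g n G := by
  have key : (∃ C : ℝ, ∀ t r, (t, r) ∈ Ω → |F t r| ≤ C * g t r) →
      ∃ C : ℝ, ∀ t r, (t, r) ∈ Ω → |G t r| ≤ C * g t r :=
    fun h => h.imp fun C hC t r hx => hFG t r hx ▸ hC t r hx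
  cases n with
  | zero => exact key hF
  | succ n =>
    obtain ⟨hb, Ft, Fr, hd, h1, h2⟩ := hF
    refine ⟨key hb, Ft, Fr, fun t r hx => ⟨?_, ?_⟩, h1, h2⟩
    · refine (hd t r hx).1.congr_of_eventuallyEq ?_
      have : ∀ᶠ s in nhds t, (s, r) ∈ Ω :=
        (Continuous.prodMk_left r).continuousAt.eventually (ho.mem_nhds hx)
      exact this.mono fun s hs => (hFG s r hs).symm
    · refine (hd t r hx).2.congr_of_eventuallyEq ?_
      have : ∀ᶠ s in nhds r, (t, s) ∈ Ω :=
        (Continuous.prodMk_right t).continuousAt.eventually (ho.mem_nhds hx)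
      exact this.mono fun s hs => (hFG t s hs).symm

theorem of_hasDerivAt {Ft Fr : ℝ → ℝ → ℝ}
    (hb : ∃ C : ℝ, ∀ t r, (t, r) ∈ Ω → |F t r| ≤ C * g t r)
    (ht : ∀ t r, (t, r) ∈ Ω → HasDerivAt (fun s => F s r) (Ft t r / t) t)
    (hr : ∀ t r, (t, r) ∈ Ω → HasDerivAt (F t) (Fr t r / r) r)
    (h1 : Symb Ω g n Ft) (h2 : Symb Ω g n Fr) : Symb Ω g (n + 1) F :=
  ⟨hb, Ft, Fr, fun t r hx => ⟨ht t r hx, hr t r hx⟩, h1, h2⟩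

theorem fst (hq : Ω ⊆ quadrant) : Symb Ω (fun t _ => t) n (fun t _ => t) := by
  have hb : ∃ C : ℝ, ∀ t r, (t, r) ∈ Ω → |t| ≤ C * t :=
    ⟨1, fun t r hx => by rw [abs_of_pos (hq hx).1, one_mul]⟩
  induction n with
  | zero => exact hb
  | succ n ih =>
    refine of_hasDerivAt hb (Ft := fun t _ => t) (Fr := fun _ _ => 0)
      (fun t r hx => ?_) (fun t r hx => ?_) ih ?_
    · rw [div_self (hq hx).1.ne']; exact hasDerivAt_id t
    · simpa using hasDerivAt_const r t
    · simpa using ih.const_mul 0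

theorem snd (hq : Ω ⊆ quadrant) : Symb Ω (fun _ r => r) n (fun _ r => r) := by
  have hb : ∃ C : ℝ, ∀ t r, (t, r) ∈ Ω → |r| ≤ C * r :=
    ⟨1, fun t r hx => by rw [abs_of_pos (hq hx).2, one_mul]⟩
  induction n with
  | zero => exact hb
  | succ n ih =>
    refine of_hasDerivAt hb (Ft := fun _ _ => 0) (Fr := fun _ r => r)
      (fun t r hx => ?_) (fun t r hx => ?_) ?_ ih
    · simpa using hasDerivAt_const t r
    · rw [div_self (hq hx).2.ne']; exact hasDerivAt_id r
    · simpa using ih.const_mul 0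

theorem inv (hlow : ∃ c : ℝ, 0 < c ∧ ∀ t r, (t, r) ∈ Ω → c * g t r ≤ F t r)
    (hg : ∀ t r, (t, r) ∈ Ω → 0 < g t r) (hF : Symb Ω g n F) :
    Symb Ω (fun t r => (g t r)⁻¹) n (fun t r => (F t r)⁻¹) := by
  obtain ⟨c, hc, hlow⟩ := hlow
  have hpos : ∀ t r, (t, r) ∈ Ω → 0 < F t r := fun t r hx =>
    (mul_pos hc (hg t r hx)).trans_le (hlow t r hx)
  have hb : ∃ C : ℝ, ∀ t r, (t, r) ∈ Ω → |(F t r)⁻¹| ≤ C * (g t r)⁻¹ := by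
    refine ⟨c⁻¹, fun t r hx => ?_⟩
    rw [abs_of_pos (inv_pos.2 (hpos t r hx)), ← mul_inv]
    exact inv_anti₀ (mul_pos hc (hg t r hx)) (hlow t r hx)
  induction n with
  | zero => exact hb
  | succ n ih =>
    have hi := ih hF.of_succ
    obtain ⟨-, Ft, Fr, hd, h1, h2⟩ := hF
    have aux : ∀ H : ℝ → ℝ → ℝ, Symb Ω g n H →
        Symb Ω (fun t r => (g t r)⁻¹) n (fun t r => -(H t r * ((F t r)⁻¹ * (F t r)⁻¹))) := by
      intro H hH
      refine ((hH.mul (hi.mul hi)).neg).congr_weight fun t r hx => ?_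
      have := (hg t r hx).ne'
      field_simp
    refine of_hasDerivAt hb (fun t r hx => ?_) (fun t r hx => ?_) (aux Ft h1) (aux Fr h2)
    · exact ((hd t r hx).1.inv (hpos t r hx).ne').congr_deriv (by
        have := (hpos t r hx).ne'; field_simp)
    · exact ((hd t r hx).2.inv (hpos t r hx).ne').congr_deriv (by
        have := (hpos t r hx).ne'; field_simp)

theorem fst_inv (hq : Ω ⊆ quadrant) : Symb Ω (fun t _ => t⁻¹) n (fun t _ => t⁻¹) :=
  (fst hq).inv ⟨1, one_pos, fun t r _ => by simp⟩ fun _ _ hx => (hq hx).1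

theorem snd_inv (hq : Ω ⊆ quadrant) : Symb Ω (fun _ r => r⁻¹) n (fun _ r => r⁻¹) :=
  (snd hq).inv ⟨1, one_pos, fun t r _ => by simp⟩ fun _ _ hx => (hq hx).2

theorem deriv_fst (ho : IsOpen Ω) (hq : Ω ⊆ quadrant) (hF : Symb Ω g (n + 1) F) :
    Symb Ω (fun t r => g t r * t⁻¹) n (fun t r => deriv (fun s => F s r) t) := by
  obtain ⟨-, Ft, Fr, hd, h1, h2⟩ := hF
  exact (h1.mul (fst_inv hq)).congr ho fun t r hx => (hd t r hx).1.deriv.symm ▸ rfl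

theorem deriv_snd (ho : IsOpen Ω) (hq : Ω ⊆ quadrant) (hF : Symb Ω g (n + 1) F) :
    Symb Ω (fun t r => g t r * r⁻¹) n (fun t r => deriv (F t) r) := by
  obtain ⟨-, Ft, Fr, hd, h1, h2⟩ := hF
  exact (h2.mul (snd_inv hq)).congr ho fun t r hx => (hd t r hx).2.deriv.symm ▸ rfl

theorem hasDerivAt_fst (hF : Symb Ω g (n + 1) F) {t r : ℝ} (hx : (t, r) ∈ Ω) :
    HasDerivAt (fun s => F s r) (deriv (fun s => F s r) t) t := by
  obtain ⟨-, Ft, Fr, hd, -⟩ := hF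
  exact (hd t r hx).1.differentiableAt.hasDerivAt

theorem hasDerivAt_snd (hF : Symb Ω g (n + 1) F) {t r : ℝ} (hx : (t, r) ∈ Ω) :
    HasDerivAt (F t) (deriv (F t) r) r := by
  obtain ⟨-, Ft, Fr, hd, -⟩ := hF
  exact (hd t r hx).2.differentiableAt.hasDerivAt

theorem of_deriv (hq : Ω ⊆ quadrant)
    (hb : ∃ C : ℝ, ∀ t r, (t, r) ∈ Ω → |F t r| ≤ C * g t r)
    (hd : ∀ t r, (t, r) ∈ Ω →
      DifferentiableAt ℝ (fun s => F s r) t ∧ DifferentiableAt ℝ (F t) r)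
    (h1 : Symb Ω (fun t r => g t r * t⁻¹) n (fun t r => deriv (fun s => F s r) t))
    (h2 : Symb Ω (fun t r => g t r * r⁻¹) n (fun t r => deriv (F t) r)) :
    Symb Ω g (n + 1) F := by
  refine of_hasDerivAt hb (fun t r hx => ?_) (fun t r hx => ?_)
    ((h1.mul (fst hq)).congr_weight fun t r hx => ?_)
    ((h2.mul (snd hq)).congr_weight fun t r hx => ?_)
  · exact (hd t r hx).1.hasDerivAt.congr_deriv
      (by have := (hq hx).1.ne'; simp only at this; field_simp)
  · exact (hd t r hx).2.hasDerivAt.congr_deriv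
      (by have := (hq hx).2.ne'; simp only at this; field_simp)
  · have := (hq hx).1.ne'; simp only at this; field_simp
  · have := (hq hx).2.ne'; simp only at this; field_simp

theorem union (ho : IsOpen Ω) (ho' : IsOpen Ω') (hq : Ω ⊆ quadrant) (hq' : Ω' ⊆ quadrant)
    (hg : ∀ t r, (t, r) ∈ Ω ∪ Ω' → 0 ≤ g t r)
    (h : Symb Ω g n F) (h' : Symb Ω' g n F) : Symb (Ω ∪ Ω') g n F := by
  have hb : ∃ C : ℝ, ∀ t r, (t, r) ∈ Ω ∪ Ω' → |F t r| ≤ C * g t r := by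
    obtain ⟨C, hC⟩ := h.bound
    obtain ⟨D, hD⟩ := h'.bound
    refine ⟨max C D, fun t r hx => ?_⟩
    rcases hx with hx | hx
    · exact (hC t r hx).trans (mul_le_mul_of_nonneg_right (le_max_left _ _) (hg t r (.inl hx)))
    · exact (hD t r hx).trans (mul_le_mul_of_nonneg_right (le_max_right _ _) (hg t r (.inr hx)))
  induction n generalizing F g with
  | zero => exact hb
  | succ n ih =>
    have hqq := Set.union_subset hq hq'
    have hg1 : ∀ t r, (t, r) ∈ Ω ∪ Ω' → 0 ≤ g t r * t⁻¹ := fun t r hx =>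
      mul_nonneg (hg t r hx) (inv_nonneg.2 (hqq hx).1.le)
    have hg2 : ∀ t r, (t, r) ∈ Ω ∪ Ω' → 0 ≤ g t r * r⁻¹ := fun t r hx =>
      mul_nonneg (hg t r hx) (inv_nonneg.2 (hqq hx).2.le)
    have glue : ∀ (g : ℝ → ℝ → ℝ) (G : ℝ → ℝ → ℝ), (∀ t r, (t, r) ∈ Ω ∪ Ω' → 0 ≤ g t r) →
        Symb Ω g n G → Symb Ω' g n G → Symb (Ω ∪ Ω') g n G := by
      intro g G hg h h'
      refine ih hg h h' ?_
      obtain ⟨C, hC⟩ := h.bound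
      obtain ⟨D, hD⟩ := h'.bound
      refine ⟨max C D, fun t r hx => ?_⟩
      rcases hx with hx | hx
      · exact (hC t r hx).trans (mul_le_mul_of_nonneg_right (le_max_left _ _) (hg t r (.inl hx)))
      · exact (hD t r hx).trans (mul_le_mul_of_nonneg_right (le_max_right _ _) (hg t r (.inr hx)))
    refine of_deriv hqq hb (fun t r hx => ?_)
      (glue _ _ hg1 (h.deriv_fst ho hq) (h'.deriv_fst ho' hq'))
      (glue _ _ hg2 (h.deriv_snd ho hq) (h'.deriv_snd ho' hq'))
    rcases hx with hx | hx
    · exact ⟨(h.hasDerivAt_fst hx).differentiableAt, (h.hasDerivAt_snd hx).differentiableAt⟩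
    · exact ⟨(h'.hasDerivAt_fst hx).differentiableAt, (h'.hasDerivAt_snd hx).differentiableAt⟩

end Symb

theorem pd_succ_left (k j : ℕ) (u : ℝ → ℝ → ℝ) :
    pd (k + 1) j u = fun t r => deriv (fun s => pd k j u s r) t := by
  funext t r
  simp only [pd]
  rw [iteratedDeriv_succ]

theorem pd_zero_succ (j : ℕ) (u : ℝ → ℝ → ℝ) :
    pd 0 (j + 1) u = fun t r => deriv (pd 0 j u t) r := by
  funext t r
  simp only [pd, iteratedDeriv_zero]
  rw [iteratedDeriv_succ]
  rfl

theorem pd_zero_zero (u : ℝ → ℝ → ℝ) : pd 0 0 u = u := by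
  funext t r
  simp [pd]

namespace Symb

variable {Ω : Set (ℝ × ℝ)} {g : ℝ → ℝ → ℝ} {F : ℝ → ℝ → ℝ} {n : ℕ}

theorem pd (ho : IsOpen Ω) (hq : Ω ⊆ quadrant) (k j : ℕ) (hF : Symb Ω g (n + k + j) F) :
    Symb Ω (fun t r => (t ^ k)⁻¹ * (r ^ j)⁻¹ * g t r) n (pd k j F) := by
  induction k generalizing n with
  | zero =>
    induction j generalizing n with
    | zero => simpa [pd_zero_zero] using hF
    | succ j ih =>
      rw [pd_zero_succ]
      have : Symb Ω g (n + 1 + 0 + j) F := by convert hF using 1; ring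
      refine ((ih this).deriv_snd ho hq).congr_weight fun t r hx => ?_
      rw [pow_succ, mul_inv]; ring
  | succ k ih =>
    rw [pd_succ_left]
    have : Symb Ω g (n + 1 + k + j) F := by convert hF using 1; ring
    refine ((ih this).deriv_fst ho hq).congr_weight fun t r hx => ?_
    rw [pow_succ, mul_inv]; ring

end Symb

open Set Filter Topology

/-- Functions on `(0, ∞)` which together with all their `t∂_t` derivatives are `O(t^p)`. -/
def PowSymb (p : ℝ) (φ : ℝ → ℝ) : Prop :=
  ∀ n, Symb quadrant (fun t _ => t ^ p) n (fun t _ => φ t)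

theorem isOpen_quadrant : IsOpen quadrant :=
  (isOpen_lt continuous_const continuous_fst).inter (isOpen_lt continuous_const continuous_snd)

namespace PowSymb

variable {p q : ℝ} {φ ψ : ℝ → ℝ}

theorem of_hasDerivAt (hb : ∃ C : ℝ, ∀ t, 0 < t → |φ t| ≤ C * t ^ p)
    (hd : ∀ t, 0 < t → HasDerivAt φ (ψ t) t) (hψ : PowSymb (p - 1) ψ) : PowSymb p φ := by
  have hb' : ∃ C : ℝ, ∀ t r, (t, r) ∈ quadrant → |φ t| ≤ C * t ^ p :=
    hb.imp fun C hC t r hx => hC t hx.1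
  intro n
  cases n with
  | zero => exact hb'
  | succ n =>
    refine Symb.of_hasDerivAt hb' (Ft := fun t _ => ψ t * t) (Fr := fun _ _ => 0) ?_ ?_ ?_ ?_
    · intro t r hx
      exact (hd t hx.1).congr_deriv (by have := hx.1.ne'; simp only at this; field_simp)
    · intro t r hx
      simpa using hasDerivAt_const r (φ t)
    · refine ((hψ n).mul (Symb.fst subset_rfl)).congr_weight fun t r hx => ?_
      have := hx.1.ne'
      simp only at this
      rw [Real.rpow_sub_one this]; field_simp
    · have := ((hψ n).mul (Symb.fst subset_rfl)).const_mul 0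
      simp only [zero_mul] at this
      refine this.congr_weight fun t r hx => ?_
      have := hx.1.ne'
      simp only at this
      rw [Real.rpow_sub_one this]; field_simp

theorem symb (h : PowSymb p φ) {Ω : Set (ℝ × ℝ)} (hΩ : Ω ⊆ quadrant) (n : ℕ) :
    Symb Ω (fun t _ => t ^ p) n (fun t _ => φ t) := (h n).mono_set hΩ

theorem bound (h : PowSymb p φ) : ∃ C : ℝ, 0 ≤ C ∧ ∀ t, 0 < t → |φ t| ≤ C * t ^ p := by
  obtain ⟨C, h0, hC⟩ := (h 0).bound_nonneg fun t r hx => Real.rpow_nonneg hx.1.le p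
  exact ⟨C, h0, fun t ht => hC t 1 ⟨ht, one_pos⟩⟩

theorem hasDerivAt (h : PowSymb p φ) {t : ℝ} (ht : 0 < t) : HasDerivAt φ (deriv φ t) t :=
  (h 1).hasDerivAt_fst (r := 1) ⟨ht, one_pos⟩

theorem deriv (h : PowSymb p φ) : PowSymb (p - 1) (deriv φ) := fun n =>
  ((h (n + 1)).deriv_fst isOpen_quadrant subset_rfl).congr_weight fun t r hx => by
    rw [Real.rpow_sub_one hx.1.ne']; rfl

theorem iteratedDeriv (h : PowSymb p φ) (k : ℕ) : PowSymb (p - k) (iteratedDeriv k φ) := by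
  induction k with
  | zero => simpa using h
  | succ k ih =>
    rw [iteratedDeriv_succ]
    have := ih.deriv
    rwa [sub_sub, ← Nat.cast_succ] at this

theorem mul (h : PowSymb p φ) (h' : PowSymb q ψ) : PowSymb (p + q) (fun t => φ t * ψ t) := fun n =>
  ((h n).mul (h' n)).congr_weight fun _ _ hx => (Real.rpow_add hx.1 p q).symm

theorem add (h : PowSymb p φ) (h' : PowSymb p ψ) : PowSymb p (fun t => φ t + ψ t) := fun n =>
  (h n).add (h' n)

theorem const_mul (c : ℝ) (h : PowSymb p φ) : PowSymb p (fun t => c * φ t) := fun n =>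
  (h n).const_mul c

theorem congr (hφ : ∀ t, 0 < t → φ t = ψ t) (h : PowSymb p φ) : PowSymb p ψ := fun n =>
  (h n).congr isOpen_quadrant fun t _ hx => hφ t hx.1

theorem contDiffOn (h : PowSymb p φ) (n : ℕ) : ContDiffOn ℝ n φ (Ioi 0) := by
  induction n generalizing p φ with
  | zero =>
    refine contDiffOn_zero.2 fun t ht => (h.hasDerivAt ht).continuousAt.continuousWithinAt
  | succ n ih =>
    push_cast
    rw [contDiffOn_succ_iff_deriv_of_isOpen isOpen_Ioi]
    exact ⟨fun t ht => (h.hasDerivAt ht).differentiableAt.differentiableWithinAt,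
      fun h => by simp at h, ih h.deriv⟩

/-- Extension by zero keeps differentiability at the origin when the order is above one. -/
theorem hasDerivAt_zero (h : PowSymb p φ) (hp : 1 < p) (h0 : ∀ t ≤ 0, φ t = 0) {t : ℝ}
    (ht : t ≤ 0) : HasDerivAt φ 0 t := by
  rcases ht.lt_or_eq with ht | rfl
  · refine (hasDerivAt_const t (0 : ℝ)).congr_of_eventuallyEq ?_
    filter_upwards [Iio_mem_nhds ht] with s hs using h0 s hs.le
  · obtain ⟨C, hC0, hC⟩ := h.bound
    rw [hasDerivAt_iff_isLittleO_nhds_zero]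
    have h1 : (fun s : ℝ => φ (0 + s) - φ 0 - s • (0 : ℝ)) =O[𝓝 0] fun s => |s| ^ p := by
      refine Asymptotics.IsBigO.of_bound C (Eventually.of_forall fun s => ?_)
      simp only [zero_add, h0 0 le_rfl, sub_zero, smul_zero, Real.norm_eq_abs]
      rw [abs_of_nonneg (Real.rpow_nonneg (abs_nonneg s) p)]
      rcases le_or_gt s 0 with hs | hs
      · rw [h0 s hs, abs_zero]; positivity
      · rw [abs_of_pos hs]; exact hC s hs
    refine h1.trans_isLittleO ?_
    have h2 : Tendsto (fun s : ℝ => |s| ^ (p - 1)) (𝓝 0) (𝓝 0) := by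
      have : Continuous fun s : ℝ => |s| ^ (p - 1) :=
        continuous_abs.rpow_const fun _ => .inr (by linarith)
      simpa [Real.zero_rpow (show p - 1 ≠ 0 by linarith)] using this.tendsto 0
    have h3 : (fun s : ℝ => |s| ^ p) = fun s => |s| ^ (p - 1) * |s| := by
      funext s
      rcases eq_or_ne s 0 with rfl | hs
      · simp [Real.zero_rpow (show p ≠ 0 by linarith)]
      · rw [← Real.rpow_add_one (abs_ne_zero.2 hs), sub_add_cancel]
    rw [h3]
    have := ((Asymptotics.isLittleO_one_iff ℝ).2 h2).mul_isBigO
      (Asymptotics.isBigO_refl (fun s : ℝ => |s|) (𝓝 0))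
    simp only [one_mul] at this
    exact this.of_abs_right

theorem contDiff (h : PowSymb p φ) (n : ℕ) (hp : n < p) (h0 : ∀ t ≤ 0, φ t = 0) :
    ContDiff ℝ n φ := by
  induction n generalizing p φ with
  | zero =>
    have hp' : 0 < p := by simpa using hp
    obtain ⟨C, hC0, hC⟩ := h.bound
    refine contDiff_zero.2 (continuous_iff_continuousAt.2 fun t => ?_)
    rcases lt_trichotomy t 0 with ht | rfl | ht
    · refine (continuousAt_const (y := (0 : ℝ))).congr ?_
      filter_upwards [Iio_mem_nhds ht] with s hs using (h0 s hs.le).symm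
    · have h2 : Tendsto (fun s : ℝ => C * |s| ^ p) (𝓝 0) (𝓝 0) := by
        have : Continuous fun s : ℝ => C * |s| ^ p :=
          continuous_const.mul (continuous_abs.rpow_const fun _ => .inr hp'.le)
        simpa [Real.zero_rpow hp'.ne'] using this.tendsto 0
      rw [ContinuousAt, h0 0 le_rfl]
      refine squeeze_zero_norm (fun s => ?_) h2
      rcases le_or_gt s 0 with hs | hs
      · rw [h0 s hs, norm_zero]; positivity
      · rw [abs_of_pos hs]; exact hC s hs
    · exact (h.hasDerivAt ht).continuousAt
  | succ n ih =>
    push_cast at hp ⊢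
    have hd0 : ∀ t ≤ 0, HasDerivAt φ 0 t := fun t ht =>
      h.hasDerivAt_zero (by have := Nat.cast_nonneg (α := ℝ) n; linarith) h0 ht
    rw [contDiff_succ_iff_deriv]
    refine ⟨fun t => ?_, fun h => by simp at h,
      ih h.deriv (by linarith) fun t ht => (hd0 t ht).deriv⟩
    rcases le_or_gt t 0 with ht | ht
    · exact (hd0 t ht).differentiableAt
    · exact (h.hasDerivAt ht).differentiableAt

theorem one_const (c : ℝ) : PowSymb 0 (fun _ => c) := fun _ =>
  (Symb.const c).congr_weight fun t _ _ => (Real.rpow_zero t).symm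

/-- A bootstrap: a function whose logarithmic derivative is of order zero. -/
theorem of_logDeriv {σ : ℝ → ℝ} (hb : ∃ C : ℝ, ∀ t, 0 < t → |φ t| ≤ C * t ^ p)
    (hσ : PowSymb 0 σ) (hd : ∀ t, 0 < t → HasDerivAt φ (φ t * σ t / t) t) : PowSymb p φ := by
  have hb' : ∃ C : ℝ, ∀ t r, (t, r) ∈ quadrant → |φ t| ≤ C * t ^ p :=
    hb.imp fun C hC t r hx => hC t hx.1
  intro n
  induction n with
  | zero => exact hb'
  | succ n ih =>
    refine Symb.of_hasDerivAt hb' (Ft := fun t _ => φ t * σ t) (Fr := fun _ _ => 0)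
      (fun t r hx => hd t hx.1) (fun t r hx => by simpa using hasDerivAt_const r (φ t))
      ((ih.mul (hσ n)).congr_weight fun t r _ => by simp) (by simpa using ih.const_mul 0)

end PowSymb

theorem pow_rpow (p : ℝ) : PowSymb p (fun t => t ^ p) := by
  refine PowSymb.of_logDeriv ⟨1, fun t ht => ?_⟩ (PowSymb.one_const p) fun t ht => ?_
  · rw [abs_of_nonneg (Real.rpow_nonneg ht.le p), one_mul]
  · refine (Real.hasDerivAt_rpow_const (.inl ht.ne')).congr_deriv ?_
    rw [Real.rpow_sub_one ht.ne']; ring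

theorem pow_sin_cos_log (n : ℕ) :
    Symb quadrant (fun t _ => t ^ (0 : ℝ)) n (fun t _ => Real.sin (Real.log t)) ∧
    Symb quadrant (fun t _ => t ^ (0 : ℝ)) n (fun t _ => Real.cos (Real.log t)) := by
  have hs : ∃ C : ℝ, ∀ t r, (t, r) ∈ quadrant → |Real.sin (Real.log t)| ≤ C * t ^ (0 : ℝ) :=
    ⟨1, fun t r _ => by simpa using Real.abs_sin_le_one _⟩
  have hc : ∃ C : ℝ, ∀ t r, (t, r) ∈ quadrant → |Real.cos (Real.log t)| ≤ C * t ^ (0 : ℝ) :=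
    ⟨1, fun t r _ => by simpa using Real.abs_cos_le_one _⟩
  induction n with
  | zero => exact ⟨hs, hc⟩
  | succ n ih =>
    constructor
    · refine Symb.of_hasDerivAt hs (Ft := fun t _ => Real.cos (Real.log t)) (Fr := fun _ _ => 0)
        (fun t r hx => ?_) (fun t r hx => by simpa using hasDerivAt_const r _) ih.2
        (by simpa using ih.1.const_mul 0)
      exact (Real.hasDerivAt_log hx.1.ne').sin.congr_deriv (by simp [div_eq_mul_inv])
    · refine Symb.of_hasDerivAt hc (Ft := fun t _ => -Real.sin (Real.log t)) (Fr := fun _ _ => 0)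
        (fun t r hx => ?_) (fun t r hx => by simpa using hasDerivAt_const r _) ih.1.neg
        (by simpa using ih.1.const_mul 0)
      exact (Real.hasDerivAt_log hx.1.ne').cos.congr_deriv (by simp [div_eq_mul_inv])

/-- The inverse square root of the scaling factor, extended by zero to `t ≤ 0`. -/
def ampl (p e t : ℝ) : ℝ := if 0 < t then t ^ p * Real.exp (e * Real.sin (Real.log t)) else 0

theorem ampl_of_pos {p e t : ℝ} (ht : 0 < t) :
    ampl p e t = t ^ p * Real.exp (e * Real.sin (Real.log t)) := if_pos ht

theorem ampl_of_nonpos {p e t : ℝ} (ht : t ≤ 0) : ampl p e t = 0 := if_neg ht.not_gt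

theorem pow_ampl (p e : ℝ) : PowSymb p (ampl p e) := by
  have hE : PowSymb 0 fun t => Real.exp (e * Real.sin (Real.log t)) := by
    refine PowSymb.of_logDeriv (σ := fun t => e * Real.cos (Real.log t))
      ⟨Real.exp |e|, fun t ht => ?_⟩ (PowSymb.const_mul e fun n => (pow_sin_cos_log n).2)
      fun t ht => ?_
    · rw [Real.abs_exp, Real.rpow_zero, mul_one]
      refine Real.exp_le_exp.2 ((le_abs_self _).trans ?_)
      rw [abs_mul]
      exact mul_le_of_le_one_right (abs_nonneg _) (Real.abs_sin_le_one _)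
    · refine ((Real.hasDerivAt_log ht.ne').sin.const_mul e).exp.congr_deriv ?_
      simp [div_eq_mul_inv]; ring
  have := (pow_rpow p).mul hE
  rw [add_zero] at this
  exact this.congr fun t ht => (ampl_of_pos ht).symm

theorem le_ampl {p e t : ℝ} (ht : 0 < t) : Real.exp (-|e|) * t ^ p ≤ ampl p e t := by
  rw [ampl_of_pos ht, mul_comm]
  refine mul_le_mul_of_nonneg_left (Real.exp_le_exp.2 ?_) (Real.rpow_nonneg ht.le p)
  refine (neg_le_neg ?_).trans (neg_abs_le _)
  rw [abs_mul]
  exact mul_le_of_le_one_right (abs_nonneg _) (Real.abs_sin_le_one _)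

/-- The region `0 < r < t/2`. -/
def innerCone : Set (ℝ × ℝ) := {p | 0 < p.2 ∧ p.2 < p.1 / 2}

/-- The open light cone `0 < r < t`. -/
def lightCone : Set (ℝ × ℝ) := {p | 0 < p.2 ∧ p.2 < p.1}

theorem lightCone_subset : lightCone ⊆ quadrant := fun _ hp => ⟨hp.1.trans hp.2, hp.1⟩

theorem innerCone_subset_lightCone : innerCone ⊆ lightCone := fun p hp =>
  ⟨hp.1, by have h1 := hp.1; have h2 := hp.2; linarith⟩

theorem innerCone_subset : innerCone ⊆ quadrant :=
  innerCone_subset_lightCone.trans lightCone_subset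

theorem isOpen_innerCone : IsOpen innerCone :=
  (isOpen_lt continuous_const continuous_snd).inter
    (isOpen_lt continuous_snd (continuous_fst.div_const 2))

theorem isOpen_lightCone : IsOpen lightCone :=
  (isOpen_lt continuous_const continuous_snd).inter (isOpen_lt continuous_snd continuous_fst)

/-- The remainder of the Taylor expansion of `φ` around `t` with `k` terms. -/
def taylorRem (k : ℕ) (φ : ℝ → ℝ) (t s : ℝ) : ℝ :=
  φ (t + s) - ∑ j ∈ Finset.range k, s ^ j / j.factorial * iteratedDeriv j φ t

theorem rpow_le_of_comparable {t x : ℝ} (p : ℝ) (ht : 0 < t) (h1 : t / 2 ≤ x) (h2 : x ≤ 2 * t) :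
    x ^ p ≤ 2 ^ |p| * t ^ p := by
  have hx : 0 < x := by linarith
  have : x ^ p = (x / t) ^ p * t ^ p := by
    rw [← Real.mul_rpow (by positivity) ht.le, div_mul_cancel₀ _ ht.ne']
  rw [this]
  refine mul_le_mul_of_nonneg_right ?_ (Real.rpow_nonneg ht.le p)
  have hu1 : 2⁻¹ ≤ x / t := by rw [le_div_iff₀ ht]; linarith
  have hu2 : x / t ≤ 2 := by rw [div_le_iff₀ ht]; linarith
  rcases le_or_gt 0 p with hp | hp
  · rw [abs_of_nonneg hp]
    exact Real.rpow_le_rpow (by positivity) hu2 hp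
  · rw [abs_of_neg hp, ← inv_inv (2 : ℝ), Real.inv_rpow (by positivity), Real.rpow_neg (by positivity),
      inv_inv]
    exact Real.rpow_le_rpow_of_nonpos (by positivity) hu1 hp.le

namespace PowSymb

variable {p : ℝ} {φ : ℝ → ℝ}

theorem hasDerivAt_taylorRem_fst (h : PowSymb p φ) (k : ℕ) {t s : ℝ} (ht : 0 < t)
    (hts : 0 < t + s) :
    HasDerivAt (fun t => taylorRem k φ t s) (taylorRem k (_root_.deriv φ) t s) t := by
  have h1 : HasDerivAt (fun t => φ (t + s)) (_root_.deriv φ (t + s)) t :=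
    (h.hasDerivAt hts).comp_add_const t s
  refine h1.sub (HasDerivAt.fun_sum fun j _ => ?_)
  have := ((h.iteratedDeriv j).hasDerivAt ht).const_mul (s ^ j / j.factorial)
  rwa [← iteratedDeriv_succ, iteratedDeriv_succ'] at this

theorem hasDerivAt_taylorRem_snd (h : PowSymb p φ) (k : ℕ) {t s : ℝ}
    (hts : 0 < t + s) :
    HasDerivAt (taylorRem (k + 1) φ t) (taylorRem k (_root_.deriv φ) t s) s := by
  have h1 : HasDerivAt (fun s => φ (t + s)) (_root_.deriv φ (t + s)) s :=
    (h.hasDerivAt hts).comp_const_add t s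
  have h2 : HasDerivAt (fun s : ℝ => ∑ j ∈ Finset.range (k + 1),
      s ^ j / j.factorial * _root_.iteratedDeriv j φ t)
      (∑ j ∈ Finset.range k, s ^ j / j.factorial * _root_.iteratedDeriv j (_root_.deriv φ) t) s := by
    simp only [Finset.sum_range_succ']
    simp only [pow_zero, Nat.factorial_zero, Nat.cast_one, div_one, one_mul]
    refine (HasDerivAt.fun_sum fun j _ => ?_).add_const _
    refine (((hasDerivAt_pow (j + 1) s).div_const _).mul_const _).congr_deriv ?_
    rw [iteratedDeriv_succ', Nat.factorial_succ]
    have := Nat.factorial_ne_zero j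
    push_cast
    field_simp
  exact h1.sub h2

theorem hasDerivAt_taylorRem_zero_snd (h : PowSymb p φ) {t s : ℝ}
    (hts : 0 < t + s) : HasDerivAt (taylorRem 0 φ t) (taylorRem 0 (_root_.deriv φ) t s) s := by
  have h1 : HasDerivAt (fun s => φ (t + s)) (_root_.deriv φ (t + s)) s :=
    (h.hasDerivAt hts).comp_const_add t s
  have h2 : ∀ ψ : ℝ → ℝ, taylorRem 0 ψ t = fun s => ψ (t + s) := fun ψ => by
    funext s; simp [taylorRem]
  rw [h2, h2]
  exact h1

theorem taylorRem_bound (h : PowSymb p φ) (k : ℕ) :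
    ∃ C : ℝ, 0 ≤ C ∧ ∀ t s, 0 < t → |s| ≤ t / 2 →
      |taylorRem k φ t s| ≤ C * (|s| ^ k * t ^ (p - k)) := by
  induction k generalizing p φ with
  | zero =>
    obtain ⟨C, hC0, hC⟩ := h.bound
    refine ⟨C * 2 ^ |p|, by positivity, fun t s ht hs => ?_⟩
    have := abs_le.1 hs
    simp only [taylorRem, Finset.range_zero, Finset.sum_empty, sub_zero, pow_zero, one_mul,
      Nat.cast_zero]
    rw [mul_assoc]
    exact (hC _ (by linarith)).trans (mul_le_mul_of_nonneg_left
      (rpow_le_of_comparable p ht (by linarith) (by linarith)) hC0)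
  | succ k ih =>
    obtain ⟨C, hC0, hC⟩ := ih h.deriv
    refine ⟨C, hC0, fun t s ht hs => ?_⟩
    have hz : taylorRem (k + 1) φ t 0 = 0 := by
      simp [taylorRem, Finset.sum_range_succ']
    have hmv := Convex.norm_image_sub_le_of_norm_hasDerivWithin_le (𝕜 := ℝ)
      (f := taylorRem (k + 1) φ t) (f' := fun s => taylorRem k (_root_.deriv φ) t s)
      (s := uIcc 0 s) (x := 0) (y := s) (C := C * (|s| ^ k * t ^ (p - 1 - k)))
      (fun x hx => ?_) (fun x hx => ?_) (convex_uIcc 0 s) left_mem_uIcc right_mem_uIcc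
    · rw [hz, sub_zero, sub_zero, Real.norm_eq_abs, Real.norm_eq_abs] at hmv
      refine hmv.trans (le_of_eq ?_)
      push_cast
      rw [show p - (k + 1) = p - 1 - k by ring]; ring
    · have hx' : |x| ≤ |s| := by simpa using abs_sub_left_of_mem_uIcc hx
      have := abs_le.1 (hx'.trans hs)
      exact (h.hasDerivAt_taylorRem_snd k (by linarith)).hasDerivWithinAt
    · have hx' : |x| ≤ |s| := by simpa using abs_sub_left_of_mem_uIcc hx
      refine (hC t x ht (hx'.trans hs)).trans ?_
      gcongr

theorem symb_taylorRem (h : PowSymb p φ) (k n : ℕ) {σ : ℝ} (hσ : |σ| = 1) :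
    Symb innerCone (fun t r => r ^ k * t ^ (p - k)) n (fun t r => taylorRem k φ t (σ * r)) := by
  have hb : ∀ (p : ℝ) (φ : ℝ → ℝ), PowSymb p φ → ∀ k : ℕ, ∃ C : ℝ, ∀ t r, (t, r) ∈ innerCone →
      |taylorRem k φ t (σ * r)| ≤ C * (r ^ k * t ^ (p - k)) := by
    intro p φ h k
    obtain ⟨C, hC0, hC⟩ := h.taylorRem_bound k
    refine ⟨C, fun t r hx => ?_⟩
    have hr : |σ * r| = r := by rw [abs_mul, hσ, one_mul, abs_of_pos hx.1]
    have := hC t (σ * r) (innerCone_subset hx).1 (hr.trans_le hx.2.le)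
    rwa [hr] at this
  induction n generalizing p φ k with
  | zero => exact hb p φ h k
  | succ n ih =>
    have hpos : ∀ t r, (t, r) ∈ innerCone → 0 < t ∧ 0 < t + σ * r := by
      intro t r hx
      have h1 := (innerCone_subset hx).1
      refine ⟨h1, ?_⟩
      have hr : |σ * r| = r := by rw [abs_mul, hσ, one_mul, abs_of_pos hx.1]
      have := neg_abs_le (σ * r)
      have h2 := hx.2
      simp only at h1 h2
      linarith
    have hmulr : ∀ t r : ℝ, HasDerivAt (fun r => σ * r) σ r := fun t r => by
      simpa using (hasDerivAt_id r).const_mul σ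
    have hT : Symb innerCone (fun t r => r ^ k * t ^ (p - k)) n
        (fun t r => t * taylorRem k (_root_.deriv φ) t (σ * r)) := by
      refine ((Symb.fst innerCone_subset).mul (ih h.deriv k)).congr_weight fun t r hx => ?_
      have ht := (hpos t r hx).1
      rw [show p - 1 - k = p - k - 1 by ring, Real.rpow_sub_one ht.ne']
      field_simp
    cases k with
    | zero =>
      refine Symb.of_hasDerivAt (hb p φ h 0)
        (Ft := fun t r => t * taylorRem 0 (_root_.deriv φ) t (σ * r))
        (Fr := fun t r => r * (σ * taylorRem 0 (_root_.deriv φ) t (σ * r)))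
        (fun t r hx => ?_) (fun t r hx => ?_) hT ?_
      · have ht := hpos t r hx
        refine (h.hasDerivAt_taylorRem_fst 0 ht.1 ht.2).congr_deriv ?_
        have := ht.1.ne'
        field_simp
      · have ht := hpos t r hx
        refine ((h.hasDerivAt_taylorRem_zero_snd ht.2).comp r (hmulr t r)).congr_deriv ?_
        have := (innerCone_subset hx).2.ne'
        simp only at this
        field_simp
      · refine ((Symb.snd innerCone_subset).mul ((ih h.deriv 0).const_mul σ)).mono_weight ?_ ?_
        · intro t r hx
          have := (hpos t r hx).1
          have := (innerCone_subset hx).2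
          simp only at this
          positivity
        · refine ⟨1, fun t r hx => ?_⟩
          have ht := (hpos t r hx).1
          have hr := hx.2
          simp only at hr
          simp only [pow_zero, one_mul, Nat.cast_zero, sub_zero]
          rw [Real.rpow_sub_one ht.ne']
          have h1 : r / t ≤ 1 := by rw [div_le_one ht]; linarith
          have h2 : 0 ≤ t ^ p := Real.rpow_nonneg ht.le p
          calc r * (t ^ p / t) = r / t * t ^ p := by ring
            _ ≤ 1 * t ^ p := mul_le_mul_of_nonneg_right h1 h2
            _ = t ^ p := one_mul _
    | succ k =>
      refine Symb.of_hasDerivAt (hb p φ h (k + 1))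
        (Ft := fun t r => t * taylorRem (k + 1) (_root_.deriv φ) t (σ * r))
        (Fr := fun t r => r * (σ * taylorRem k (_root_.deriv φ) t (σ * r)))
        (fun t r hx => ?_) (fun t r hx => ?_) hT ?_
      · have ht := hpos t r hx
        refine (h.hasDerivAt_taylorRem_fst (k + 1) ht.1 ht.2).congr_deriv ?_
        have := ht.1.ne'
        field_simp
      · have ht := hpos t r hx
        refine ((h.hasDerivAt_taylorRem_snd k ht.2).comp r (hmulr t r)).congr_deriv ?_
        have := (innerCone_subset hx).2.ne'
        simp only at this
        field_simp
      · refine ((Symb.snd innerCone_subset).mul ((ih h.deriv k).const_mul σ)).congr_weight ?_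
        intro t r hx
        push_cast
        rw [show p - (k + 1) = p - 1 - k by ring]
        ring

theorem symb_comp_add (h : PowSymb p φ) (n : ℕ) :
    Symb lightCone (fun t _ => t ^ p) n (fun t r => φ (t + r)) := by
  have hb : ∀ (p : ℝ) (φ : ℝ → ℝ), PowSymb p φ → ∃ C : ℝ, ∀ t r, (t, r) ∈ lightCone →
      |φ (t + r)| ≤ C * t ^ p := by
    intro p φ h
    obtain ⟨C, hC0, hC⟩ := h.bound
    refine ⟨C * 2 ^ |p|, fun t r hx => ?_⟩
    have h1 := (lightCone_subset hx).1
    have h2 := hx.1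
    have h3 := hx.2
    simp only at h1 h2 h3
    rw [mul_assoc]
    exact (hC _ (by linarith)).trans (mul_le_mul_of_nonneg_left
      (rpow_le_of_comparable p h1 (by linarith) (by linarith)) hC0)
  induction n generalizing p φ with
  | zero => exact hb p φ h
  | succ n ih =>
    refine Symb.of_hasDerivAt (hb p φ h)
      (Ft := fun t r => t * _root_.deriv φ (t + r)) (Fr := fun t r => r * _root_.deriv φ (t + r))
      (fun t r hx => ?_) (fun t r hx => ?_) ?_ ?_
    · have h1 := lightCone_subset hx
      refine ((h.hasDerivAt (add_pos h1.1 h1.2)).comp_add_const t r).congr_deriv ?_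
      have := h1.1.ne'
      simp only at this
      field_simp
    · have h1 := lightCone_subset hx
      refine ((h.hasDerivAt (add_pos h1.1 h1.2)).comp_const_add t r).congr_deriv ?_
      have := h1.2.ne'
      simp only at this
      field_simp
    · refine ((Symb.fst lightCone_subset).mul (ih h.deriv)).congr_weight fun t r hx => ?_
      have := (lightCone_subset hx).1.ne'
      simp only at this
      rw [Real.rpow_sub_one this]
      field_simp
    · refine ((Symb.snd lightCone_subset).mul (ih h.deriv)).mono_weight (fun t r hx => ?_)
        ⟨1, fun t r hx => ?_⟩
      · have h1 := lightCone_subset hx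
        exact mul_nonneg h1.2.le (Real.rpow_nonneg h1.1.le _)
      · have h1 := lightCone_subset hx
        have h2 := hx.2
        simp only [quadrant, mem_ofPred_eq] at h1 h2
        rw [Real.rpow_sub_one h1.1.ne', one_mul, mul_div_assoc', div_le_iff₀ h1.1, mul_comm]
        exact mul_le_mul_of_nonneg_left h2.le (Real.rpow_nonneg h1.1.le _)

theorem symb_comp_sub (h : PowSymb p φ) (n : ℕ) (hn : n ≤ p) :
    Symb lightCone (fun t _ => t ^ p) n (fun t r => φ (t - r)) := by
  have hb : ∀ (p : ℝ) (φ : ℝ → ℝ), 0 ≤ p → PowSymb p φ → ∃ C : ℝ, ∀ t r, (t, r) ∈ lightCone →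
      |φ (t - r)| ≤ C * t ^ p := by
    intro p φ hp h
    obtain ⟨C, hC0, hC⟩ := h.bound
    refine ⟨C, fun t r hx => ?_⟩
    have h2 := hx.1
    have h3 := hx.2
    simp only at h2 h3
    exact (hC _ (by linarith)).trans (mul_le_mul_of_nonneg_left
      (Real.rpow_le_rpow (by linarith) (by linarith) hp) hC0)
  induction n generalizing p φ with
  | zero => exact hb p φ (by simpa using hn) h
  | succ n ih =>
    push_cast at hn
    have hn' : (n : ℝ) ≤ p - 1 := by linarith
    refine Symb.of_hasDerivAt (hb p φ (by have := Nat.cast_nonneg (α := ℝ) n; linarith) h)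
      (Ft := fun t r => t * _root_.deriv φ (t - r)) (Fr := fun t r => r * -_root_.deriv φ (t - r))
      (fun t r hx => ?_) (fun t r hx => ?_) ?_ ?_
    · have h1 := lightCone_subset hx
      refine ((h.hasDerivAt (sub_pos.2 hx.2)).comp_sub_const t r).congr_deriv ?_
      have := h1.1.ne'
      simp only at this
      field_simp
    · have h1 := lightCone_subset hx
      refine ((h.hasDerivAt (sub_pos.2 hx.2)).comp_const_sub t r).congr_deriv ?_
      have := h1.2.ne'
      simp only at this
      field_simp
    · refine ((Symb.fst lightCone_subset).mul (ih h.deriv hn')).congr_weight fun t r hx => ?_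
      have := (lightCone_subset hx).1.ne'
      simp only at this
      rw [Real.rpow_sub_one this]
      field_simp
    · refine ((Symb.snd lightCone_subset).mul (ih h.deriv hn').neg).mono_weight (fun t r hx => ?_)
        ⟨1, fun t r hx => ?_⟩
      · have h1 := lightCone_subset hx
        exact mul_nonneg h1.2.le (Real.rpow_nonneg h1.1.le _)
      · have h1 := lightCone_subset hx
        have h2 := hx.2
        simp only [quadrant, mem_ofPred_eq] at h1 h2
        rw [Real.rpow_sub_one h1.1.ne', one_mul, mul_div_assoc', div_le_iff₀ h1.1, mul_comm]
        exact mul_le_mul_of_nonneg_left h2.le (Real.rpow_nonneg h1.1.le _)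

end PowSymb

/-- One-variable symbols on `(0, ∞)` with weight `g`. -/
def SymbOne (g h : ℝ → ℝ) : Prop := ∀ n, Symb quadrant (fun y _ => g y) n (fun y _ => h y)

namespace SymbOne

variable {g g' g₁ g₂ h h₁ h₂ : ℝ → ℝ}

theorem of_step (hb : ∃ C : ℝ, ∀ y, 0 < y → |h y| ≤ C * g y)
    (hd : ∀ y, 0 < y → HasDerivAt h (h₁ y / y) y)
    (step : ∀ n, Symb quadrant (fun y _ => g y) n (fun y _ => h y) →
      Symb quadrant (fun y _ => g y) n (fun y _ => h₁ y)) : SymbOne g h := by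
  have hb' : ∃ C : ℝ, ∀ y r, (y, r) ∈ quadrant → |h y| ≤ C * g y :=
    hb.imp fun C hC y r hx => hC y hx.1
  intro n
  induction n with
  | zero => exact hb'
  | succ n ih =>
    exact Symb.of_hasDerivAt hb' (Ft := fun y _ => h₁ y) (Fr := fun _ _ => 0)
      (fun y r hx => hd y hx.1) (fun y r hx => by simpa using hasDerivAt_const r (h y))
      (step n ih) (by simpa using ih.const_mul 0)

theorem of_hasDerivAt (hb : ∃ C : ℝ, ∀ y, 0 < y → |h y| ≤ C * g y)
    (hd : ∀ y, 0 < y → HasDerivAt h (h₁ y / y) y) (h1 : SymbOne g h₁) : SymbOne g h :=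
  of_step hb hd fun n _ => h1 n

theorem mul (h1 : SymbOne g₁ h₁) (h2 : SymbOne g₂ h₂) :
    SymbOne (fun y => g₁ y * g₂ y) (fun y => h₁ y * h₂ y) := fun n => (h1 n).mul (h2 n)

theorem add (h1 : SymbOne g h₁) (h2 : SymbOne g h₂) :
    SymbOne g (fun y => h₁ y + h₂ y) := fun n => (h1 n).add (h2 n)

theorem sub (h1 : SymbOne g h₁) (h2 : SymbOne g h₂) :
    SymbOne g (fun y => h₁ y - h₂ y) := fun n => (h1 n).sub (h2 n)

theorem const_mul (c : ℝ) (h1 : SymbOne g h) : SymbOne g (fun y => c * h y) := fun n =>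
  (h1 n).const_mul c

theorem pow (h1 : SymbOne g h) (k : ℕ) : SymbOne (fun y => g y ^ k) (fun y => h y ^ k) :=
  fun n => (h1 n).pow k

theorem mono (hg : ∀ y, 0 < y → 0 ≤ g y) (hgg : ∃ C : ℝ, ∀ y, 0 < y → g y ≤ C * g' y)
    (h1 : SymbOne g h) : SymbOne g' h := fun n =>
  (h1 n).mono_weight (fun y _ hx => hg y hx.1) (hgg.imp fun _ hC y _ hx => hC y hx.1)

theorem congr (hh : ∀ y, 0 < y → h₁ y = h₂ y) (h1 : SymbOne g h₁) : SymbOne g h₂ := fun n =>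
  (h1 n).congr isOpen_quadrant fun y _ hx => hh y hx.1

theorem id : SymbOne (fun y => y) (fun y => y) := fun _ => Symb.fst subset_rfl

theorem mul_deriv (h1 : SymbOne g h) : SymbOne g (fun y => y * deriv h y) := fun n =>
  ((Symb.fst subset_rfl).mul ((h1 (n + 1)).deriv_fst isOpen_quadrant subset_rfl)).congr_weight
    fun y r hx => by
      have := hx.1.ne'
      simp only at this
      field_simp

theorem hasDerivAt (h1 : SymbOne g h) {y : ℝ} (hy : 0 < y) : HasDerivAt h (deriv h y) y :=
  (h1 1).hasDerivAt_fst (r := 1) ⟨hy, one_pos⟩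

end SymbOne

/-- The Japanese bracket `√(1 + y²)`. -/
def jb (y : ℝ) : ℝ := Real.sqrt (1 + y ^ 2)

theorem jb_sq (y : ℝ) : jb y ^ 2 = 1 + y ^ 2 := Real.sq_sqrt (by positivity)

theorem jb_pos (y : ℝ) : 0 < jb y := Real.sqrt_pos.2 (by positivity)

theorem one_le_jb (y : ℝ) : 1 ≤ jb y := by
  have := jb_sq y
  nlinarith [jb_pos y, sq_nonneg y]

theorem jb_inv_le_one (y : ℝ) : (jb y)⁻¹ ≤ 1 := inv_le_one_of_one_le₀ (one_le_jb y)

theorem le_jb (y : ℝ) : y ≤ jb y := by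
  have := jb_sq y
  nlinarith [jb_pos y]

theorem hasDerivAt_jb (y : ℝ) : HasDerivAt jb (y / jb y) y := by
  have h1 : HasDerivAt (fun y : ℝ => 1 + y ^ 2) (2 * y) y := by
    simpa using (hasDerivAt_pow 2 y).const_add 1
  refine (h1.sqrt (by positivity)).congr_deriv ?_
  have := (jb_pos y).ne'
  rw [← jb]
  field_simp

theorem hasDerivAt_jb_inv (y : ℝ) : HasDerivAt (fun y => (jb y)⁻¹) (-y * (jb y)⁻¹ ^ 3) y := by
  refine ((hasDerivAt_jb y).inv (jb_pos y).ne').congr_deriv ?_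
  have := (jb_pos y).ne'
  field_simp

theorem symbOne_jb_inv : SymbOne (fun y => (jb y)⁻¹) (fun y => (jb y)⁻¹) := by
  refine SymbOne.of_step (h₁ := fun y => (jb y)⁻¹ ^ 3 - (jb y)⁻¹) ⟨1, fun y _ => ?_⟩
    (fun y hy => ?_) fun n hn => ?_
  · rw [abs_of_pos (inv_pos.2 (jb_pos y)), one_mul]
  · refine (hasDerivAt_jb_inv y).congr_deriv ?_
    have := (jb_pos y).ne'
    have := jb_sq y
    field_simp
    linear_combination this
  · refine ((hn.pow 3).mono_weight (fun y _ _ => ?_) ⟨1, fun y _ _ => ?_⟩).sub hn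
    · have := jb_pos y
      positivity
    · rw [one_mul]
      exact pow_le_of_le_one (inv_pos.2 (jb_pos y)).le (jb_inv_le_one y) (by norm_num)

theorem symbOne_jb : SymbOne jb jb := fun n => by
  have := (symbOne_jb_inv n).inv ⟨1, one_pos, fun y _ _ => (one_mul _).le⟩
    fun y _ _ => inv_pos.2 (jb_pos y)
  simpa using this

/-- `log (1 + y²)`. -/
def lg (y : ℝ) : ℝ := Real.log (1 + y ^ 2)

theorem lg_nonneg (y : ℝ) : 0 ≤ lg y := Real.log_nonneg (by nlinarith [sq_nonneg y])

theorem hasDerivAt_lg (y : ℝ) : HasDerivAt lg (2 * y / (1 + y ^ 2)) y := by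
  have h1 : HasDerivAt (fun y : ℝ => 1 + y ^ 2) (2 * y) y := by
    simpa using (hasDerivAt_pow 2 y).const_add 1
  exact h1.log (by positivity)

theorem symbOne_mul_jb_inv : SymbOne (fun _ => 1) (fun y => y * (jb y)⁻¹) := by
  refine (SymbOne.id.mul symbOne_jb_inv).mono (fun y hy => ?_) ⟨1, fun y hy => ?_⟩
  · have := jb_pos y
    positivity
  · rw [mul_one, ← div_eq_mul_inv, div_le_one (jb_pos y)]
    exact le_jb y

theorem symbOne_lg : SymbOne (fun y => 1 + lg y) lg := by
  refine SymbOne.of_hasDerivAt (h₁ := fun y => 2 * (y * (jb y)⁻¹) ^ 2) ⟨1, fun y _ => ?_⟩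
    (fun y hy => ?_) ?_
  · rw [abs_of_nonneg (lg_nonneg y)]; linarith
  · refine (hasDerivAt_lg y).congr_deriv ?_
    rw [← jb_sq]
    have := (jb_pos y).ne'
    field_simp
  · refine ((symbOne_mul_jb_inv.pow 2).const_mul 2).mono (fun y _ => by positivity)
      ⟨1, fun y _ => ?_⟩
    have := lg_nonneg y
    linarith

theorem symbOne_lg' : SymbOne (fun y => y) lg := by
  refine SymbOne.of_hasDerivAt (h₁ := fun y => y * (2 * ((y * (jb y)⁻¹) * (jb y)⁻¹)))
    ⟨2, fun y hy => ?_⟩ (fun y hy => ?_) ?_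
  · rw [abs_of_nonneg (lg_nonneg y)]
    have h1 : lg y = 2 * Real.log (jb y) := by
      rw [lg, ← jb_sq, Real.log_pow]; norm_num
    have h2 := Real.log_le_sub_one_of_pos (jb_pos y)
    have h3 : jb y ≤ 1 + y := by
      have := jb_sq y
      nlinarith [jb_pos y]
    linarith
  · refine (hasDerivAt_lg y).congr_deriv ?_
    rw [← jb_sq]
    have := (jb_pos y).ne'
    field_simp
  · refine (SymbOne.id.mul ((symbOne_mul_jb_inv.mul symbOne_jb_inv).const_mul 2)).mono
      (fun y hy => ?_) ⟨1, fun y hy => ?_⟩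
    · have := jb_pos y
      positivity
    · have := jb_inv_le_one y
      nlinarith

theorem hasDerivAt_arctan' (y : ℝ) : HasDerivAt Real.arctan (1 / (1 + y ^ 2)) y :=
  Real.hasDerivAt_arctan y

theorem symbOne_arctan_sub :
    SymbOne (fun y => (jb y)⁻¹) (fun y => Real.arctan y - Real.pi / 2) := by
  refine SymbOne.of_hasDerivAt (h₁ := fun y => (y * (jb y)⁻¹) * (jb y)⁻¹)
    ⟨Real.pi / 2, fun y hy => ?_⟩ (fun y hy => ?_) ?_
  · have h1 := Real.arctan_lt_pi_div_two y
    have h2 := Real.arctan_pos.2 hy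
    have h3 := Real.mul_le_sin (x := Real.pi / 2 - Real.arctan y) (by linarith) (by linarith)
    rw [Real.sin_pi_div_two_sub, Real.cos_arctan, ← jb] at h3
    rw [abs_sub_comm, abs_of_pos (by linarith)]
    rw [one_div] at h3
    have h4 := Real.pi_pos
    calc Real.pi / 2 - Real.arctan y
        = Real.pi / 2 * (2 / Real.pi * (Real.pi / 2 - Real.arctan y)) := by field_simp
      _ ≤ _ := by gcongr
  · refine ((hasDerivAt_arctan' y).sub_const _).congr_deriv ?_
    rw [← jb_sq]
    have := (jb_pos y).ne'
    field_simp
  · exact (symbOne_mul_jb_inv.mul symbOne_jb_inv).mono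
      (fun y _ => by have := jb_pos y; positivity) ⟨1, fun y _ => by simp⟩

theorem symbOne_arctan_div : SymbOne (fun _ => 1) (fun y => Real.arctan y / y) := by
  refine SymbOne.of_step (h₁ := fun y => (jb y)⁻¹ ^ 2 - Real.arctan y / y)
    ⟨1, fun y hy => ?_⟩ (fun y hy => ?_) fun n hn => ?_
  · have h2 := Real.arctan_pos.2 hy
    rw [abs_of_pos (by positivity), mul_one, div_le_one hy]
    have := Real.lt_tan h2 (Real.arctan_lt_pi_div_two y)
    rw [Real.tan_arctan] at this
    exact this.le
  · refine ((hasDerivAt_arctan' y).div (hasDerivAt_id y) hy.ne').congr_deriv ?_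
    rw [← jb_sq]
    have := (jb_pos y).ne'
    have := hy.ne'
    simp only [id]
    field_simp
  · refine ((((symbOne_jb_inv.pow 2).mono (fun y _ => ?_) ⟨1, fun y _ => ?_⟩) :
      SymbOne _ _) n).sub hn
    · have := jb_pos y
      positivity
    · rw [one_mul]
      exact pow_le_one₀ (inv_pos.2 (jb_pos y)).le (jb_inv_le_one y)

theorem symbOne_jb_sub : SymbOne (fun y => (jb y)⁻¹) (fun y => jb y - y) := by
  refine SymbOne.of_step (h₁ := fun y => -((y * (jb y)⁻¹) * (jb y - y)))
    ⟨1, fun y hy => ?_⟩ (fun y hy => ?_) fun n hn => ?_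
  · rw [abs_of_nonneg (sub_nonneg.2 (le_jb y)), one_mul, ← one_div, le_div_iff₀ (jb_pos y)]
    have := jb_sq y
    nlinarith [le_jb y]
  · refine ((hasDerivAt_jb y).sub (hasDerivAt_id y)).congr_deriv ?_
    have := (jb_pos y).ne'
    have := hy.ne'
    field_simp
    ring
  · exact ((symbOne_mul_jb_inv n).mul hn).neg.congr_weight fun y _ _ => by simp

/-- `arctan y / y - 1`, with its limit value at the origin. -/
def kap (y : ℝ) : ℝ := if y = 0 then 0 else Real.arctan y / y - 1

theorem kap_of_ne {y : ℝ} (hy : y ≠ 0) : kap y = Real.arctan y / y - 1 := if_neg hy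

theorem hasDerivAt_kap {y : ℝ} (hy : y ≠ 0) :
    HasDerivAt kap ((1 / (1 + y ^ 2) - Real.arctan y / y) / y) y := by
  have h1 : HasDerivAt (fun y => Real.arctan y / y - 1)
      ((1 / (1 + y ^ 2) - Real.arctan y / y) / y) y := by
    refine (((hasDerivAt_arctan' y).div (hasDerivAt_id y) hy).sub_const 1).congr_deriv ?_
    simp only [id]
    field_simp
  refine h1.congr_of_eventuallyEq ?_
  filter_upwards [isOpen_ne.mem_nhds hy] with z hz using kap_of_ne hz

theorem symbOne_kap : SymbOne (fun y => y * (jb y)⁻¹) kap := by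
  refine SymbOne.of_step (h₁ := fun y => -((y * (jb y)⁻¹) * (y * (jb y)⁻¹)) - kap y)
    ⟨1, fun y hy => ?_⟩ (fun y hy => ?_) fun n hn => ?_
  · have h2 := Real.arctan_pos.2 hy
    have h3 := Real.lt_tan h2 (Real.arctan_lt_pi_div_two y)
    rw [Real.tan_arctan] at h3
    have h4 : y / (1 + y ^ 2) ≤ Real.arctan y := by
      have h5 := Real.sin_le h2.le
      have h6 := Real.cos_le_one (Real.arctan y)
      have h7 := Real.sin_arctan y
      have h8 := Real.cos_arctan y
      rw [← jb] at h7 h8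
      have hj := jb_pos y
      have : y / (1 + y ^ 2) = Real.sin (Real.arctan y) * Real.cos (Real.arctan y) := by
        rw [h7, h8, ← jb_sq]; field_simp
      rw [this]
      have : 0 ≤ Real.sin (Real.arctan y) := by rw [h7]; positivity
      nlinarith
    rw [kap_of_ne hy.ne', abs_sub_comm, abs_of_nonneg (by
      rw [sub_nonneg, div_le_one hy]; exact h3.le), one_mul]
    have hj := jb_pos y
    have h9 : 1 - Real.arctan y / y ≤ (y * (jb y)⁻¹) ^ 2 := by
      have h10 : 1 / (1 + y ^ 2) ≤ Real.arctan y / y := by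
        rw [le_div_iff₀ hy]
        calc _ = y / (1 + y ^ 2) := by ring
          _ ≤ _ := h4
      have h11 : (y * (jb y)⁻¹) ^ 2 = 1 - 1 / (1 + y ^ 2) := by
        rw [← jb_sq]
        field_simp
        linear_combination - jb_sq y
      linarith
    refine h9.trans (pow_le_of_le_one (by positivity) ?_ (by norm_num))
    rw [← div_eq_mul_inv, div_le_one hj]
    exact le_jb y
  · refine (hasDerivAt_kap hy.ne').congr_deriv ?_
    rw [kap_of_ne hy.ne', ← jb_sq]
    have := (jb_pos y).ne'
    have := hy.ne'
    field_simp
    linear_combination (-y) * jb_sq y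
  · have h1 : SymbOne (fun y => y * (jb y)⁻¹) (fun y => -((y * (jb y)⁻¹) * (y * (jb y)⁻¹))) := by
      intro n
      refine ((symbOne_mul_jb_inv n).mul ((SymbOne.id.mul symbOne_jb_inv) n)).neg.congr_weight
        fun y _ _ => by simp
    exact (h1 n).sub hn

/-- The bracket in the first correction profile. -/
def profBracket (y : ℝ) : ℝ :=
  3 * y ^ 4 - 6 * y ^ 2 + 15 / 2 * (1 - y ^ 2) * lg y + 15 / 4 * (1 - 6 * y ^ 2 + y ^ 4) * kap y

/-- The first correction profile. -/
def profOne (y : ℝ) : ℝ := (jb y)⁻¹ ^ 3 * profBracket y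

/-- The second correction profile. -/
def profTwo (y : ℝ) : ℝ := (jb y)⁻¹ ^ 3 * (3 / 2 * y ^ 2 * (1 - y ^ 2))

/-- The scaling generator applied to the ground state. -/
def scalOne (y : ℝ) : ℝ := (jb y)⁻¹ ^ 3 * ((1 - y ^ 2) / 2)

/-- The scaling generator applied twice to the ground state. -/
def scalTwo (y : ℝ) : ℝ := (jb y)⁻¹ ^ 5 * (1 / 4 - 5 / 2 * y ^ 2 + 1 / 4 * y ^ 4)

theorem hasDerivAt_jb_inv_cube_mul {G : ℝ → ℝ} {G' y : ℝ} (hG : HasDerivAt G G' y) :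
    HasDerivAt (fun y => (jb y)⁻¹ ^ 3 * G y)
      ((jb y)⁻¹ ^ 3 * (G' - 3 * (y / (1 + y ^ 2)) * G y)) y := by
  refine (((hasDerivAt_jb_inv y).pow 3).mul hG).congr_deriv ?_
  rw [← jb_sq]
  have := (jb_pos y).ne'
  simp only [Pi.pow_apply, Nat.cast_ofNat, Nat.add_one_sub_one]
  field_simp
  ring

/-- `h` solves the linearised radial equation with right-hand side `b`. -/
def LinRadial (h b : ℝ → ℝ) : Prop :=
  ∃ h' h'' : ℝ → ℝ, ∀ y, 0 < y → HasDerivAt h (h' y) y ∧ HasDerivAt h' (h'' y) y ∧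
    h'' y + 2 / y * h' y + 15 * (jb y)⁻¹ ^ 4 * h y = b y

theorem linRadial_jb_inv_cube_mul {G G' G'' b : ℝ → ℝ}
    (h1 : ∀ y, 0 < y → HasDerivAt G (G' y) y) (h2 : ∀ y, 0 < y → HasDerivAt G' (G'' y) y)
    (hb : ∀ y, 0 < y → G'' y - 6 * (y / (1 + y ^ 2)) * G' y
      + (-3 * (1 - y ^ 2) + 9 * y ^ 2) / (1 + y ^ 2) ^ 2 * G y
      + 2 / y * (G' y - 3 * (y / (1 + y ^ 2)) * G y) + 15 / (1 + y ^ 2) ^ 2 * G y = b y) :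
    LinRadial (fun y => (jb y)⁻¹ ^ 3 * G y) (fun y => (jb y)⁻¹ ^ 3 * b y) := by
  refine ⟨fun y => (jb y)⁻¹ ^ 3 * (G' y - 3 * (y / (1 + y ^ 2)) * G y),
    fun y => (jb y)⁻¹ ^ 3 * (G'' y - 6 * (y / (1 + y ^ 2)) * G' y
      + (-3 * (1 - y ^ 2) + 9 * y ^ 2) / (1 + y ^ 2) ^ 2 * G y), fun y hy =>
    ⟨hasDerivAt_jb_inv_cube_mul (h1 y hy), ?_, ?_⟩⟩
  · have hq : HasDerivAt (fun y : ℝ => y / (1 + y ^ 2)) ((1 - y ^ 2) / (1 + y ^ 2) ^ 2) y := by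
      refine ((hasDerivAt_id y).div ((hasDerivAt_pow 2 y).const_add 1)
        (by positivity)).congr_deriv ?_
      have : (1 + y ^ 2) ≠ 0 := by positivity
      simp only [id]
      field_simp
      norm_num
      ring
    refine (hasDerivAt_jb_inv_cube_mul
      ((h2 y hy).sub ((hq.const_mul 3).mul (h1 y hy)))).congr_deriv ?_
    congr 1
    simp only [Pi.sub_apply, Pi.mul_apply]
    have : (1 + y ^ 2) ≠ 0 := by positivity
    field_simp
    ring
  · simp only
    rw [← hb y hy]
    have h4 : (jb y)⁻¹ ^ 4 = 1 / (1 + y ^ 2) ^ 2 := by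
      rw [← jb_sq]; have := (jb_pos y).ne'; field_simp
    rw [h4]
    ring

theorem hasDerivAt_profBracket {y : ℝ} (hy : 0 < y) : HasDerivAt profBracket
    (12 * y ^ 3 - 12 * y + 15 / 2 * (1 - y ^ 2) * (2 * y / (1 + y ^ 2)) - 15 * y * lg y
      + 15 / 4 * (1 - 6 * y ^ 2 + y ^ 4) * ((1 / (1 + y ^ 2) - Real.arctan y / y) / y)
      + 15 / 4 * (-12 * y + 4 * y ^ 3) * (Real.arctan y / y - 1)) y := by
  have e2 := hasDerivAt_pow 2 y
  have e4 := hasDerivAt_pow 4 y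
  refine ((((e4.const_mul 3).sub (e2.const_mul 6)).add (((e2.const_sub 1).const_mul (15 / 2)).mul
    (hasDerivAt_lg y))).add (((((e2.const_mul 6).const_sub 1).add e4).const_mul (15 / 4)).mul
    (hasDerivAt_kap hy.ne'))).congr_deriv ?_
  rw [kap_of_ne hy.ne']
  have : (1 + y ^ 2) ≠ 0 := by positivity
  norm_num
  ring

theorem linRadial_profOne : LinRadial profOne (fun y => 3 * scalOne y) := by
  have key : LinRadial profOne (fun y => (jb y)⁻¹ ^ 3 * (3 / 2 * (1 - y ^ 2))) := by
    refine linRadial_jb_inv_cube_mul (fun y hy => hasDerivAt_profBracket hy) (fun y hy => ?_)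
      (G'' := fun y => 36 * y ^ 2 - 12
        + 15 / 2 * (-2 * y) * (2 * y / (1 + y ^ 2))
        + 15 / 2 * (1 - y ^ 2) * (2 * (1 - y ^ 2) / (1 + y ^ 2) ^ 2)
        - 15 * lg y - 15 * y * (2 * y / (1 + y ^ 2))
        + 15 / 4 * (-12 * y + 4 * y ^ 3) * ((1 / (1 + y ^ 2) - Real.arctan y / y) / y)
        + 15 / 4 * (1 - 6 * y ^ 2 + y ^ 4) *
          ((-2 * y / (1 + y ^ 2) ^ 2 - (1 / (1 + y ^ 2) - Real.arctan y / y) / y) / y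
            - (1 / (1 + y ^ 2) - Real.arctan y / y) / y ^ 2)
        + 15 / 4 * (-12 * y + 4 * y ^ 3) * ((1 / (1 + y ^ 2) - Real.arctan y / y) / y)
        + 15 / 4 * (-12 + 12 * y ^ 2) * (Real.arctan y / y - 1)) (fun y hy => ?_)
    · have e1 := hasDerivAt_id' y
      have e2 := hasDerivAt_pow 2 y
      have e3 := hasDerivAt_pow 3 y
      have e4 := hasDerivAt_pow 4 y
      have eq : HasDerivAt (fun y : ℝ => 1 / (1 + y ^ 2)) (-2 * y / (1 + y ^ 2) ^ 2) y := by
        refine ((hasDerivAt_const y (1 : ℝ)).div (e2.const_add 1) (by positivity)).congr_deriv ?_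
        norm_num
      have eb : HasDerivAt (fun y => Real.arctan y / y)
          ((1 / (1 + y ^ 2) - Real.arctan y / y) / y) y := by
        refine ((hasDerivAt_arctan' y).div e1 hy.ne').congr_deriv ?_
        field_simp
      refine (((((((e3.const_mul 12).sub (e1.const_mul 12)).add
        (((e2.const_sub 1).const_mul (15 / 2)).mul
          ((e1.const_mul 2).div (e2.const_add 1) (by positivity)))).sub
        ((e1.const_mul 15).mul (hasDerivAt_lg y)))).add
        (((((e2.const_mul 6).const_sub 1).add e4).const_mul (15 / 4)).mul
          ((eq.sub eb).div e1 hy.ne'))).add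
        ((((e1.const_mul (-12)).add (e3.const_mul 4)).const_mul (15 / 4)).mul
          (eb.sub_const 1))).congr_deriv ?_
      have : (1 + y ^ 2) ≠ 0 := by positivity
      norm_num
      field_simp
      ring
    · have : (1 + y ^ 2) ≠ 0 := by positivity
      simp only [profBracket, kap_of_ne hy.ne']
      field_simp
      ring
  obtain ⟨h', h'', h⟩ := key
  refine ⟨h', h'', fun y hy => ⟨(h y hy).1, (h y hy).2.1, (h y hy).2.2.trans ?_⟩⟩
  simp only [scalOne]; ring

theorem linRadial_profTwo : LinRadial profTwo (fun y => 12 * (scalOne y + scalTwo y)) := by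
  have key : LinRadial profTwo (fun y => (jb y)⁻¹ ^ 3 *
      (12 * ((1 - y ^ 2) / 2 + (1 / 4 - 5 / 2 * y ^ 2 + 1 / 4 * y ^ 4) / (1 + y ^ 2)))) := by
    refine linRadial_jb_inv_cube_mul (G' := fun y => 3 * y - 6 * y ^ 3)
      (G'' := fun y => 3 - 18 * y ^ 2) (fun y hy => ?_) (fun y hy => ?_) (fun y hy => ?_)
    · have e2 := hasDerivAt_pow 2 y
      refine ((e2.const_mul (3 / 2)).mul (e2.const_sub 1)).congr_deriv ?_
      norm_num; ring
    · refine (((hasDerivAt_id' y).const_mul 3).sub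
        ((hasDerivAt_pow 3 y).const_mul 6)).congr_deriv ?_
      norm_num; ring
    · have : (1 + y ^ 2) ≠ 0 := by positivity
      field_simp
      ring
  obtain ⟨h', h'', h⟩ := key
  refine ⟨h', h'', fun y hy => ⟨(h y hy).1, (h y hy).2.1, (h y hy).2.2.trans ?_⟩⟩
  simp only [scalOne, scalTwo]
  rw [← jb_sq]
  have := (jb_pos y).ne'
  field_simp

theorem hasDerivAt_jb_inv_scal (y : ℝ) :
    HasDerivAt (fun y => (jb y)⁻¹) (-y * (jb y)⁻¹ ^ 3) y ∧
    (jb y)⁻¹ / 2 + y * (-y * (jb y)⁻¹ ^ 3) = scalOne y := by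
  refine ⟨hasDerivAt_jb_inv y, ?_⟩
  rw [scalOne]
  have := (jb_pos y).ne'
  field_simp
  linear_combination jb_sq y

theorem hasDerivAt_scalOne (y : ℝ) :
    HasDerivAt scalOne ((jb y)⁻¹ ^ 3 * (-y - 3 * (y / (1 + y ^ 2)) * ((1 - y ^ 2) / 2))) y ∧
    scalOne y / 2 + y * ((jb y)⁻¹ ^ 3 * (-y - 3 * (y / (1 + y ^ 2)) * ((1 - y ^ 2) / 2)))
      = scalTwo y := by
  constructor
  · have : HasDerivAt (fun y : ℝ => (1 - y ^ 2) / 2) (-y) y := by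
      refine (((hasDerivAt_pow 2 y).const_sub 1).div_const 2).congr_deriv ?_
      norm_num; ring
    exact hasDerivAt_jb_inv_cube_mul this
  · have h5 : (jb y)⁻¹ ^ 5 = (jb y)⁻¹ ^ 3 / (1 + y ^ 2) := by
      rw [← jb_sq]; have := (jb_pos y).ne'; field_simp
    have : (1 + y ^ 2) ≠ 0 := by positivity
    rw [scalOne, scalTwo, h5]
    field_simp
    ring

theorem hasDerivAt_jb_inv_deriv (y : ℝ) :
    HasDerivAt (fun y => -y * (jb y)⁻¹ ^ 3) (-(jb y)⁻¹ ^ 3 + 3 * y ^ 2 * (jb y)⁻¹ ^ 5) y := by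
  refine ((hasDerivAt_id' y).neg.mul ((hasDerivAt_jb_inv y).pow 3)).congr_deriv ?_
  norm_num
  ring

theorem symbOne_one_le {g h : ℝ → ℝ} (hg0 : ∀ y, 0 < y → 0 ≤ g y)
    (hg : ∀ y, 0 < y → g y ≤ 1) (hh : SymbOne g h) : SymbOne (fun _ => 1) h :=
  hh.mono hg0 ⟨1, fun y hy => by simpa using hg y hy⟩

theorem symbOne_jb_inv' : SymbOne (fun _ => 1) (fun y => (jb y)⁻¹) :=
  symbOne_one_le (fun y _ => (inv_pos.2 (jb_pos y)).le) (fun y _ => jb_inv_le_one y) symbOne_jb_inv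

/-- Multiplication by a symbol of weight one keeps the weight. -/
theorem SymbOne.one_mul {g h h' : ℝ → ℝ} (h1 : SymbOne (fun _ => 1) h) (h2 : SymbOne g h') :
    SymbOne g (fun y => h y * h' y) := fun n =>
  ((h1 n).mul (h2 n)).congr_weight fun _ _ _ => _root_.one_mul _

theorem symbOne_profTwo : SymbOne (fun y => y) profTwo := by
  have h1 := symbOne_mul_jb_inv
  have h2 := symbOne_jb_inv'
  have h3 : SymbOne (fun _ => 1) (fun y => 3 / 2 * ((y * (jb y)⁻¹) *
      ((jb y)⁻¹ * (jb y)⁻¹ - (y * (jb y)⁻¹) * (y * (jb y)⁻¹)))) :=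
    (h1.one_mul ((h2.one_mul h2).sub (h1.one_mul h1))).const_mul _
  refine (h3.one_mul SymbOne.id).congr fun y _ => ?_
  rw [profTwo]; ring

theorem symbOne_profOne : SymbOne (fun y => y) profOne := by
  have h1 := symbOne_mul_jb_inv
  have h2 := symbOne_jb_inv'
  have h3 : SymbOne (fun y => y) (fun y => 3 * (((y * (jb y)⁻¹) * ((y * (jb y)⁻¹) *
      (y * (jb y)⁻¹))) * y)) := ((h1.one_mul (h1.one_mul h1)).one_mul SymbOne.id).const_mul 3
  have h4 : SymbOne (fun y => y) (fun y => 6 * (((y * (jb y)⁻¹) * ((jb y)⁻¹ *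
      (jb y)⁻¹)) * y)) := ((h1.one_mul (h2.one_mul h2)).one_mul SymbOne.id).const_mul 6
  have h5 : SymbOne (fun _ => 1) (fun y => 15 / 2 * ((jb y)⁻¹ *
      ((jb y)⁻¹ * (jb y)⁻¹ - (y * (jb y)⁻¹) * (y * (jb y)⁻¹)))) :=
    (h2.one_mul ((h2.one_mul h2).sub (h1.one_mul h1))).const_mul _
  have h6 := h5.one_mul symbOne_lg'
  have h7 : SymbOne (fun _ => 1) (fun y => 15 / 4 * ((((jb y)⁻¹ * (jb y)⁻¹) * ((jb y)⁻¹ * (jb y)⁻¹)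
      - 6 * ((y * (jb y)⁻¹) * (y * (jb y)⁻¹)) * ((jb y)⁻¹ * (jb y)⁻¹)) +
      ((y * (jb y)⁻¹) * (y * (jb y)⁻¹)) * ((y * (jb y)⁻¹) * (y * (jb y)⁻¹)))) :=
    (((h2.one_mul h2).one_mul (h2.one_mul h2)).sub
      (((h1.one_mul h1).const_mul 6).one_mul (h2.one_mul h2)) |>.add
      ((h1.one_mul h1).one_mul (h1.one_mul h1))).const_mul _
  have h8 : SymbOne (fun y => y) (fun y => jb y * kap y) := by
    intro n
    refine ((symbOne_jb n).mul (symbOne_kap n)).congr_weight fun y _ _ => ?_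
    have := (jb_pos y).ne'
    field_simp
  refine (((h3.sub h4).add h6).add (h7.one_mul h8)).congr fun y _ => ?_
  rw [profOne, profBracket]
  have := (jb_pos y).ne'
  field_simp

theorem symbOne_weight_of_jb_inv {h : ℝ → ℝ} (hh : SymbOne (fun y => (jb y)⁻¹) h) :
    SymbOne (fun y => (jb y)⁻¹ * (1 + lg y)) h :=
  hh.mono (fun y _ => (inv_pos.2 (jb_pos y)).le) ⟨1, fun y _ => by
    have h1 := inv_pos.2 (jb_pos y)
    have h2 := lg_nonneg y
    nlinarith⟩

theorem symbOne_profTwo_add :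
    SymbOne (fun y => (jb y)⁻¹ * (1 + lg y)) (fun y => profTwo y + 3 / 2 * y) := by
  refine symbOne_weight_of_jb_inv ?_
  have h2 := symbOne_jb_inv'
  refine ((((symbOne_jb_inv.const_mul 3).sub ((h2.one_mul (h2.one_mul symbOne_jb_inv)).const_mul
    2)).sub symbOne_jb_sub).const_mul (3 / 2)).congr fun y _ => ?_
  have h3 : y ^ 2 = jb y ^ 2 - 1 := by rw [jb_sq]; ring
  rw [profTwo, h3]
  have := (jb_pos y).ne'
  field_simp
  ring

theorem symbOne_profOne_add :
    SymbOne (fun y => (jb y)⁻¹ * (1 + lg y))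
      (fun y => profOne y + 3 / 4 * y - 15 / 8 * Real.pi) := by
  have h1 := symbOne_mul_jb_inv
  have h2 := symbOne_jb_inv'
  have hu := symbOne_jb_inv
  have hb := symbOne_arctan_div
  have hp : SymbOne (fun y => (jb y)⁻¹) (fun y =>
      (((18 * (jb y)⁻¹ - 21 * ((jb y)⁻¹ * ((jb y)⁻¹ * (jb y)⁻¹))) - 3 / 4 * (jb y - y)) +
      15 / 4 * ((Real.arctan y / y) * (8 * ((jb y)⁻¹ * ((jb y)⁻¹ * (jb y)⁻¹)) - 7 * (jb y)⁻¹))) +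
      (15 / 4 * ((y * (jb y)⁻¹) * (Real.arctan y - Real.pi / 2)) -
        15 / 8 * Real.pi * ((jb y)⁻¹ * (jb y - y)))) := by
    have hu3 := h2.one_mul (h2.one_mul hu)
    exact ((((hu.const_mul 18).sub (hu3.const_mul 21)).sub (symbOne_jb_sub.const_mul _)).add
      ((hb.one_mul ((hu3.const_mul 8).sub (hu.const_mul 7))).const_mul _)).add
      (((h1.one_mul symbOne_arctan_sub).const_mul _).sub ((h2.one_mul symbOne_jb_sub).const_mul _))
  have hl : SymbOne (fun y => (jb y)⁻¹ * (1 + lg y)) (fun y =>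
      (15 / 2 * (2 * ((jb y)⁻¹ * ((jb y)⁻¹ * (jb y)⁻¹)) - (jb y)⁻¹)) * lg y) :=
    SymbOne.mul ((((h2.one_mul (h2.one_mul hu)).const_mul 2).sub hu).const_mul _) symbOne_lg
  refine ((symbOne_weight_of_jb_inv hp).add hl).congr fun y hy => ?_
  rw [profOne, profBracket, kap_of_ne hy.ne']
  have h3 := jb_sq y
  have h4 : y ^ 4 = (jb y ^ 2 - 1) ^ 2 := by rw [jb_sq]; ring
  have h5 : y ^ 2 = jb y ^ 2 - 1 := by rw [jb_sq]; ring
  have h7 : Real.arctan y / y * jb y =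
      (jb y)⁻¹ * (Real.arctan y / y) + y * (jb y)⁻¹ * Real.arctan y := by
    have := (jb_pos y).ne'
    field_simp
    linear_combination h3
  rw [h4, h5]
  generalize Real.arctan y / y = b at *
  have := (jb_pos y).ne'
  have h8 : y * (jb y)⁻¹ * Real.arctan y = b * jb y - (jb y)⁻¹ * b := by rw [h7]; ring
  have h9 : y * (jb y)⁻¹ * (Real.arctan y - Real.pi / 2)
      = b * jb y - (jb y)⁻¹ * b - y * (jb y)⁻¹ * (Real.pi / 2) := by rw [← h8]; ring
  rw [h9]
  field_simp
  ring

theorem contDiff_jb_inv {n : WithTop ℕ∞} : ContDiff ℝ n (fun y => (jb y)⁻¹) := by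
  refine ContDiff.inv (ContDiff.sqrt (by fun_prop) fun y => ?_) fun y => (jb_pos y).ne'
  positivity

theorem contDiff_lg {n : WithTop ℕ∞} : ContDiff ℝ n lg :=
  ContDiff.log (by fun_prop) fun y => by positivity

theorem contDiff_kap (n : ℕ) : ContDiff ℝ n kap := by
  rw [contDiff_iff_contDiffAt]
  intro y
  rcases eq_or_ne y 0 with rfl | hy
  · have h1 : AnalyticAt ℝ Real.arctan 0 :=
      (Real.contDiff_arctan (n := ⊤)).contDiffAt.analyticAt
    obtain ⟨p, hp⟩ := h1
    have h2 : AnalyticAt ℝ (dslope Real.arctan 0) 0 := ⟨_, hp.has_fpower_series_dslope_fslope⟩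
    have h3 : kap = fun y => dslope Real.arctan 0 y - 1 := by
      funext y
      rcases eq_or_ne y 0 with rfl | hy
      · simp [kap]
      · rw [kap_of_ne hy, dslope_of_ne _ hy, slope_def_field]; simp
    rw [h3]
    exact h2.contDiffAt.sub contDiffAt_const
  · refine ContDiffAt.congr_of_eventuallyEq (f := fun y => Real.arctan y / y - 1) ?_ ?_
    · exact (Real.contDiff_arctan.contDiffAt.div contDiffAt_id hy).sub contDiffAt_const
    · filter_upwards [isOpen_ne.mem_nhds hy] with z hz using kap_of_ne hz

theorem contDiff_profOne (n : ℕ) : ContDiff ℝ n profOne := by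
  have h1 := contDiff_kap n
  have h2 := contDiff_lg (n := n)
  have h3 := contDiff_jb_inv (n := n)
  unfold profOne profBracket
  fun_prop

theorem contDiff_profTwo (n : ℕ) : ContDiff ℝ n profTwo := by
  have h3 := contDiff_jb_inv (n := n)
  unfold profTwo
  fun_prop

/-- `A` behaves like a pure power `t^p` to infinite order, and vanishes for `t ≤ 0`. -/
structure Amp (p : ℝ) (A : ℝ → ℝ) : Prop where
  pow : PowSymb p A
  low : ∃ c : ℝ, 0 < c ∧ ∀ t, 0 < t → c * t ^ p ≤ A t
  nonpos : ∀ t ≤ 0, A t = 0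

theorem PowSymb.cast {p q : ℝ} {φ : ℝ → ℝ} (h : PowSymb p φ) (hpq : p = q) : PowSymb q φ := hpq ▸ h

/-- The rescaled radius. -/
def scl (A : ℝ → ℝ) (t r : ℝ) : ℝ := r / (Real.sqrt 3 * A t ^ 2)

/-- The coefficient of the first profile. -/
def coefK (A : ℝ → ℝ) (t : ℝ) : ℝ := A t ^ 2 * deriv (deriv A) t + A t * deriv A t ^ 2

/-- A primitive of the slowly decaying part of the first correction. -/
def primB (A : ℝ → ℝ) (t : ℝ) : ℝ := ∫ s in (0 : ℝ)..t, -(15 / 4 * Real.pi) * coefK A s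

namespace Amp

variable {p : ℝ} {A : ℝ → ℝ} {Ω : Set (ℝ × ℝ)}

theorem pos (hA : Amp p A) {t : ℝ} (ht : 0 < t) : 0 < A t := by
  obtain ⟨c, hc, h⟩ := hA.low
  exact (mul_pos hc (Real.rpow_pos_of_pos ht p)).trans_le (h t ht)

theorem rpow_le (hA : Amp p A) (m j : ℕ) :
    ∃ C : ℝ, 0 ≤ C ∧ ∀ t, 0 < t → t ^ (m * p - j) ≤ C * (A t ^ m * (t ^ j)⁻¹) := by
  obtain ⟨c, hc, h⟩ := hA.low
  refine ⟨(c⁻¹) ^ m, by positivity, fun t ht => ?_⟩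
  have h1 : t ^ p ≤ c⁻¹ * A t := by
    rw [← div_eq_inv_mul, le_div_iff₀ hc, mul_comm]; exact h t ht
  have h2 : t ^ (m * p - j) = (t ^ p) ^ m * (t ^ j)⁻¹ := by
    rw [Real.rpow_sub ht, mul_comm, Real.rpow_mul ht.le, Real.rpow_natCast, Real.rpow_natCast,
      div_eq_mul_inv]
  rw [h2, ← mul_assoc, ← mul_pow]
  gcongr

theorem symb_pow (hA : Amp p A) (hΩ : Ω ⊆ quadrant) {m j : ℕ} {φ : ℝ → ℝ}
    (hφ : PowSymb (m * p - j) φ) (n : ℕ) :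
    Symb Ω (fun t _ => A t ^ m * (t ^ j)⁻¹) n (fun t _ => φ t) := by
  refine (hφ.symb hΩ n).mono_weight (fun t r hx => Real.rpow_nonneg (hΩ hx).1.le _) ?_
  obtain ⟨C, -, hC⟩ := hA.rpow_le m j
  exact ⟨C, fun t r hx => hC t (hΩ hx).1⟩

theorem symb (hA : Amp p A) (hΩ : Ω ⊆ quadrant) (n : ℕ) :
    Symb Ω (fun t _ => A t) n (fun t _ => A t) :=
  (hA.symb_pow hΩ (m := 1) (j := 0) (hA.pow.cast (by simp)) n).congr_weight fun t r _ => by simp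

theorem symb_inv (hA : Amp p A) (hΩ : Ω ⊆ quadrant) (n : ℕ) :
    Symb Ω (fun t _ => (A t)⁻¹) n (fun t _ => (A t)⁻¹) :=
  (hA.symb hΩ n).inv ⟨1, one_pos, fun t r _ => by simp⟩ fun _ _ hx => hA.pos (hΩ hx).1

theorem pow_deriv (hA : Amp p A) : PowSymb (p - 1) (deriv A) := hA.pow.deriv

theorem pow_deriv2 (hA : Amp p A) : PowSymb (p - 1 - 1) (deriv (deriv A)) := hA.pow.deriv.deriv

theorem pow_AA'2 (hA : Amp p A) : PowSymb (3 * p - 2) (fun t => A t * deriv A t ^ 2) :=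
  ((hA.pow.mul (hA.pow_deriv.mul hA.pow_deriv)).cast (by ring)).congr fun t _ => by ring

theorem pow_coefK (hA : Amp p A) : PowSymb (3 * p - 2) (coefK A) := by
  have h : PowSymb (3 * p - 2) (fun t => A t ^ 2 * deriv (deriv A) t) :=
    (((hA.pow.mul hA.pow).mul hA.pow_deriv2).cast (by ring)).congr fun t _ => by ring
  exact h.add hA.pow_AA'2

theorem coefK_nonpos (hA : Amp p A) {t : ℝ} (ht : t ≤ 0) : coefK A t = 0 := by
  simp [coefK, hA.nonpos t ht]

theorem continuous_coefK (hA : Amp p A) (hp : 2 < p) : Continuous (coefK A) :=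
  (hA.pow_coefK.contDiff 0 (by push_cast; linarith) fun t ht => hA.coefK_nonpos ht).continuous

theorem hasDerivAt_primB (hA : Amp p A) (hp : 2 < p) (t : ℝ) :
    HasDerivAt (primB A) (-(15 / 4 * Real.pi) * coefK A t) t := by
  have h := (continuous_const (y := -(15 / 4 * Real.pi))).mul (hA.continuous_coefK hp)
  exact (h.integral_hasStrictDerivAt 0 t).hasDerivAt

theorem primB_nonpos (hA : Amp p A) {t : ℝ} (ht : t ≤ 0) : primB A t = 0 := by
  rw [primB, intervalIntegral.integral_congr (g := fun _ => 0)]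
  · simp
  · intro s hs
    rw [uIcc_of_ge ht] at hs
    simp [hA.coefK_nonpos hs.2]

theorem pow_primB (hA : Amp p A) (hp : 2 < p) : PowSymb (3 * p - 1) (primB A) := by
  obtain ⟨C, hC0, hC⟩ := (hA.pow_coefK.const_mul (-(15 / 4 * Real.pi))).bound
  refine PowSymb.of_hasDerivAt ⟨C, fun t ht => ?_⟩ (fun t _ => hA.hasDerivAt_primB hp t)
    ((hA.pow_coefK.const_mul (-(15 / 4 * Real.pi))).cast (by ring))
  have := intervalIntegral.norm_integral_le_of_norm_le_const (a := 0) (b := t)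
    (f := fun s => -(15 / 4 * Real.pi) * coefK A s) (C := C * t ^ (3 * p - 2)) (fun s hs => ?_)
  · rw [sub_zero, abs_of_pos ht, mul_assoc, ← Real.rpow_add_one ht.ne'] at this
    rw [primB, ← Real.norm_eq_abs]
    refine this.trans (le_of_eq ?_)
    congr 2; ring
  · rw [uIoc_of_le ht.le] at hs
    exact (hC s hs.1).trans (mul_le_mul_of_nonneg_left
      (Real.rpow_le_rpow hs.1.le hs.2 (by linarith)) hC0)

theorem hasDerivAt_scl_fst (hA : Amp p A) {t : ℝ} (r : ℝ) (ht : 0 < t) :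
    HasDerivAt (fun t => scl A t r) (-2 * (deriv A t * (A t)⁻¹) * scl A t r) t := by
  have h3 : Real.sqrt 3 ≠ 0 := by positivity
  have hpos := hA.pos ht
  have := (hasDerivAt_const t r).div (((hA.pow.hasDerivAt ht).pow 2).const_mul (Real.sqrt 3))
    (mul_ne_zero h3 (pow_ne_zero 2 hpos.ne'))
  refine this.congr_deriv ?_
  rw [scl]
  simp only [Pi.pow_apply, Nat.cast_ofNat, Nat.add_one_sub_one]
  have := hpos.ne'
  field_simp
  ring

theorem hasDerivAt_scl_snd (t r : ℝ) :
    HasDerivAt (scl A t) ((Real.sqrt 3 * A t ^ 2)⁻¹) r := by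
  have := (hasDerivAt_id r).div_const (Real.sqrt 3 * A t ^ 2)
  rw [one_div] at this
  exact this

theorem scl_pos (hA : Amp p A) {t r : ℝ} (ht : 0 < t) (hr : 0 < r) : 0 < scl A t r := by
  have := hA.pos ht
  rw [scl]; positivity

theorem symb_logDeriv (hA : Amp p A) (hΩ : Ω ⊆ quadrant) (n : ℕ) :
    Symb Ω (fun _ _ => 1) n (fun t _ => t * (deriv A t * (A t)⁻¹)) := by
  refine ((Symb.fst hΩ).mul ((hA.symb_pow hΩ (m := 1) (j := 1)
    (hA.pow_deriv.cast (by simp)) n).mul (hA.symb_inv hΩ n))).congr_weight fun t r hx => ?_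
  have h1 := (hA.pos (hΩ hx).1).ne'
  have h2 := (hΩ hx).1.ne'
  simp only at h1 h2
  field_simp

/-- One-variable symbols of the rescaled radius are symbols. -/
theorem symb_comp_scl (hA : Amp p A) (hΩ : Ω ⊆ quadrant) {g h : ℝ → ℝ} (hh : SymbOne g h)
    (n : ℕ) : Symb Ω (fun t r => g (scl A t r)) n (fun t r => h (scl A t r)) := by
  have hb : ∀ h, SymbOne g h → ∃ C : ℝ, ∀ t r, (t, r) ∈ Ω →
      |h (scl A t r)| ≤ C * g (scl A t r) := by
    intro h hh
    obtain ⟨C, hC⟩ := (hh 0).bound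
    exact ⟨C, fun t r hx => hC _ 1 ⟨hA.scl_pos (hΩ hx).1 (hΩ hx).2, one_pos⟩⟩
  induction n generalizing h with
  | zero => exact hb h hh
  | succ n ih =>
    have hs := hA.symb_logDeriv hΩ n
    refine Symb.of_hasDerivAt (hb h hh)
      (Ft := fun t r => -2 * (t * (deriv A t * (A t)⁻¹) * (scl A t r * deriv h (scl A t r))))
      (Fr := fun t r => scl A t r * deriv h (scl A t r)) (fun t r hx => ?_) (fun t r hx => ?_)
      (((hs.mul (ih hh.mul_deriv)).const_mul (-2)).congr_weight fun t r _ => one_mul _)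
      (ih hh.mul_deriv)
    · have h1 := hh.hasDerivAt (hA.scl_pos (hΩ hx).1 (hΩ hx).2)
      refine (h1.comp t (hA.hasDerivAt_scl_fst r (hΩ hx).1)).congr_deriv ?_
      have := (hΩ hx).1.ne'
      simp only at this ⊢
      field_simp
    · have h1 := hh.hasDerivAt (hA.scl_pos (hΩ hx).1 (hΩ hx).2)
      refine (h1.comp r (hasDerivAt_scl_snd t r)).congr_deriv ?_
      have h1 := (hA.pos (hΩ hx).1).ne'
      have h2 := (hΩ hx).2.ne'
      simp only at h1 h2 ⊢
      rw [show (Real.sqrt 3 * A t ^ 2)⁻¹ = scl A t r / r by rw [scl]; field_simp]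
      ring

end Amp

/-- The rescaled ground state. -/
def solU (A : ℝ → ℝ) (t r : ℝ) : ℝ := (A t)⁻¹ * (jb (scl A t r))⁻¹

/-- The first correction. -/
def corrOne (A : ℝ → ℝ) (t r : ℝ) : ℝ :=
  -2 * coefK A t * profOne (scl A t r) + A t * deriv A t ^ 2 * profTwo (scl A t r)

/-- The numerator of the part of the second correction that cancels the growth of the first. -/
def waveA (A : ℝ → ℝ) (t r : ℝ) : ℝ := r ^ 2 * deriv (deriv A) t + 2 * A t - A (t + r) - A (t - r)

/-- The numerator of the part of the second correction that cancels the limit of the first. -/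
def waveB (A : ℝ → ℝ) (t r : ℝ) : ℝ :=
  2 * r * (-(15 / 4 * Real.pi) * coefK A t) - primB A (t + r) + primB A (t - r)

/-- The second correction. -/
def corrTwo (A : ℝ → ℝ) (t r : ℝ) : ℝ :=
  (-(Real.sqrt 3 / 2) * waveA A t r - 1 / 2 * waveB A t r) / r

/-- The part of the first correction that decays in the rescaled radius. -/
def decayPart (A : ℝ → ℝ) (t r : ℝ) : ℝ :=
  corrOne A t r - Real.sqrt 3 / 2 * r * deriv (deriv A) t + 15 / 4 * Real.pi * coefK A t

/-- The region `t/4 < r < t`. -/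
def outerCone : Set (ℝ × ℝ) := {p | p.1 / 4 < p.2 ∧ 0 < p.2 ∧ p.2 < p.1}

theorem outerCone_subset : outerCone ⊆ lightCone := fun _ hp => hp.2

theorem isOpen_outerCone : IsOpen outerCone :=
  (isOpen_lt (continuous_fst.div_const 4) continuous_snd).inter isOpen_lightCone

theorem innerCone_union_outerCone : innerCone ∪ outerCone = lightCone := by
  ext x
  constructor
  · rintro (h | h)
    · exact innerCone_subset_lightCone h
    · exact outerCone_subset h
  · intro h
    by_cases h1 : x.2 < x.1 / 2
    · exact .inl ⟨h.1, h1⟩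
    · exact .inr ⟨by have := (lightCone_subset h).1; linarith, h⟩

namespace Amp

variable {p : ℝ} {A : ℝ → ℝ} {Ω : Set (ℝ × ℝ)}

theorem symb_coefK (hA : Amp p A) (hΩ : Ω ⊆ quadrant) (n : ℕ) :
    Symb Ω (fun t _ => A t ^ 3 * (t ^ 2)⁻¹) n (fun t _ => coefK A t) :=
  hA.symb_pow hΩ (hA.pow_coefK.cast (by norm_num)) n

theorem symb_AA'2 (hA : Amp p A) (hΩ : Ω ⊆ quadrant) (n : ℕ) :
    Symb Ω (fun t _ => A t ^ 3 * (t ^ 2)⁻¹) n (fun t _ => A t * deriv A t ^ 2) :=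
  hA.symb_pow hΩ (hA.pow_AA'2.cast (by norm_num)) n

theorem symb_corrOne (hA : Amp p A) (hΩ : Ω ⊆ quadrant) (n : ℕ) :
    Symb Ω (fun t r => A t * (r * (t ^ 2)⁻¹)) n (corrOne A) := by
  have h1 := (hA.symb_coefK hΩ n).const_mul (-2) |>.mul (hA.symb_comp_scl hΩ symbOne_profOne n)
  have h2 := (hA.symb_AA'2 hΩ n).mul (hA.symb_comp_scl hΩ symbOne_profTwo n)
  refine (h1.add h2).mono_weight (fun t r hx => ?_) ⟨(Real.sqrt 3)⁻¹, fun t r hx => ?_⟩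
  · have h3 := hA.pos (hΩ hx).1
    have h4 := hA.scl_pos (hΩ hx).1 (hΩ hx).2
    have h5 := (hΩ hx).1
    simp only at h3 h4 h5 ⊢
    positivity
  · have h3 := (hA.pos (hΩ hx).1).ne'
    have h5 := (hΩ hx).1.ne'
    simp only at h3 h5 ⊢
    rw [scl]
    refine le_of_eq ?_
    field_simp

theorem symb_decayPart (hA : Amp p A) (hΩ : Ω ⊆ quadrant) (ho : IsOpen Ω) (n : ℕ) :
    Symb Ω (fun t r => A t ^ 3 * (t ^ 2)⁻¹ * ((jb (scl A t r))⁻¹ * (1 + lg (scl A t r)))) n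
      (decayPart A) := by
  have h1 := (hA.symb_coefK hΩ n).const_mul (-2) |>.mul (hA.symb_comp_scl hΩ symbOne_profOne_add n)
  have h2 := (hA.symb_AA'2 hΩ n).mul (hA.symb_comp_scl hΩ symbOne_profTwo_add n)
  refine (h1.add h2).congr ho fun t r hx => ?_
  have h3 := (hA.pos (hΩ hx).1).ne'
  have h4 : Real.sqrt 3 * A t ^ 2 * scl A t r = r := by
    rw [scl]; simp only at h3; field_simp
  have h5 : Real.sqrt 3 ^ 2 = 3 := Real.sq_sqrt (by norm_num)
  rw [decayPart, corrOne, coefK]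
  linear_combination (-Real.sqrt 3 / 2 * deriv (deriv A) t) * h4 +
    (1 / 2 * A t ^ 2 * scl A t r * deriv (deriv A) t) * h5

/-- The weight of the second correction. -/
def wTwo (A : ℝ → ℝ) (t r : ℝ) : ℝ := A t * (r ^ 3 * (t ^ 4)⁻¹) + A t ^ 3 * (r ^ 2 * (t ^ 4)⁻¹)

theorem wTwo_terms_nonneg (hA : Amp p A) {t r : ℝ} (ht : 0 < t) (hr : 0 < r) :
    0 ≤ A t * (r ^ 3 * (t ^ 4)⁻¹) ∧ 0 ≤ A t ^ 3 * (r ^ 2 * (t ^ 4)⁻¹) := by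
  have := hA.pos ht
  constructor <;> positivity

theorem waveA_eq (A : ℝ → ℝ) (t r : ℝ) :
    waveA A t r = -(taylorRem 4 A t (1 * r) + taylorRem 4 A t (-1 * r)) := by
  simp only [waveA, taylorRem, Finset.sum_range_succ, Finset.sum_range_zero, Nat.factorial,
    iteratedDeriv_zero, iteratedDeriv_succ]
  rw [show t + 1 * r = t + r by ring, show t + -1 * r = t - r by ring]
  push_cast
  ring

theorem waveB_eq (hA : Amp p A) (hp : 2 < p) (t r : ℝ) :
    waveB A t r = -(taylorRem 3 (primB A) t (1 * r) - taylorRem 3 (primB A) t (-1 * r)) := by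
  simp only [waveB, taylorRem, Finset.sum_range_succ, Finset.sum_range_zero, Nat.factorial,
    iteratedDeriv_zero, iteratedDeriv_succ]
  rw [show t + 1 * r = t + r by ring, show t + -1 * r = t - r by ring,
    (hA.hasDerivAt_primB hp t).deriv]
  push_cast
  ring

theorem symb_corrTwo_inner (hA : Amp p A) (hp : 2 < p) (n : ℕ) :
    Symb innerCone (wTwo A) n (corrTwo A) := by
  have hq := innerCone_subset
  have key : ∀ σ : ℝ, |σ| = 1 → Symb innerCone (wTwo A) n
      (fun t r => r⁻¹ * taylorRem 4 A t (σ * r)) ∧ Symb innerCone (wTwo A) n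
      (fun t r => r⁻¹ * taylorRem 3 (primB A) t (σ * r)) := by
    intro σ hσ
    constructor
    · refine ((Symb.snd_inv hq).mul (hA.pow.symb_taylorRem 4 n hσ)).mono_weight
        (fun t r hx => ?_) ?_
      · have h1 := (hq hx).1
        have h2 := (hq hx).2
        simp only at h1 h2
        positivity
      · obtain ⟨C, hC0, hC⟩ := hA.rpow_le 1 4
        refine ⟨C, fun t r hx => ?_⟩
        have h1 := (hq hx).1
        have h2 := (hq hx).2
        simp only at h1 h2
        have h3 := hC t h1
        have h4 := hA.wTwo_terms_nonneg h1 h2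
        simp only [Nat.cast_one, one_mul, pow_one] at h3
        calc r⁻¹ * (r ^ 4 * t ^ (p - (4 : ℕ))) = r ^ 3 * t ^ (p - (4 : ℕ)) := by field_simp
          _ ≤ r ^ 3 * (C * (A t * (t ^ 4)⁻¹)) := by gcongr
          _ = C * (A t * (r ^ 3 * (t ^ 4)⁻¹)) := by ring
          _ ≤ C * wTwo A t r := mul_le_mul_of_nonneg_left (by rw [wTwo]; linarith [h4.2]) hC0
    · refine ((Symb.snd_inv hq).mul ((hA.pow_primB hp).symb_taylorRem 3 n hσ)).mono_weight
        (fun t r hx => ?_) ?_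
      · have h1 := (hq hx).1
        have h2 := (hq hx).2
        simp only at h1 h2
        positivity
      · obtain ⟨C, hC0, hC⟩ := hA.rpow_le 3 4
        refine ⟨C, fun t r hx => ?_⟩
        have h1 := (hq hx).1
        have h2 := (hq hx).2
        simp only at h1 h2
        have h3 := hC t h1
        have h4 := hA.wTwo_terms_nonneg h1 h2
        have h5 : 3 * p - 1 - (3 : ℕ) = (3 : ℕ) * p - (4 : ℕ) := by push_cast; ring
        rw [h5]
        calc r⁻¹ * (r ^ 3 * t ^ ((3 : ℕ) * p - (4 : ℕ)))
            = r ^ 2 * t ^ ((3 : ℕ) * p - (4 : ℕ)) := by field_simp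
          _ ≤ r ^ 2 * (C * (A t ^ 3 * (t ^ 4)⁻¹)) := by gcongr
          _ = C * (A t ^ 3 * (r ^ 2 * (t ^ 4)⁻¹)) := by ring
          _ ≤ C * wTwo A t r := mul_le_mul_of_nonneg_left (by rw [wTwo]; linarith [h4.1]) hC0
  have h1 := key 1 (by simp)
  have h2 := key (-1) (by simp)
  refine (((h1.1.add h2.1).const_mul (Real.sqrt 3 / 2)).add
    ((h1.2.sub h2.2).const_mul (1 / 2))).congr isOpen_innerCone fun t r _ => ?_
  rw [corrTwo, waveA_eq A, hA.waveB_eq hp]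
  ring

theorem symb_corrTwo_outer (hA : Amp p A) (hp : 2 < p) :
    Symb outerCone (wTwo A) 2 (corrTwo A) := by
  have hq := outerCone_subset.trans lightCone_subset
  have hconv : ∀ (m j : ℕ) (F : ℝ → ℝ → ℝ), ((m = 1 ∧ j = 0) ∨ (m = 3 ∧ j = 1)) →
      Symb outerCone (fun t _ => A t ^ m * (t ^ j)⁻¹) 2 F →
      Symb outerCone (wTwo A) 2 (fun t r => r⁻¹ * F t r) := by
    intro m j F hmj hF
    refine ((Symb.snd_inv hq).mul hF).mono_weight (fun t r hx => ?_) ⟨4 ^ 4, fun t r hx => ?_⟩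
    · have h1 := (hq hx).1
      have h2 := (hq hx).2
      have h3 := hA.pos h1
      simp only at h1 h2 h3
      positivity
    · have h1 := (hq hx).1
      have h2 := (hq hx).2
      have h3 := hA.pos h1
      have h5 := hx.1
      simp only at h1 h2 h3 h5
      have h4 := hA.wTwo_terms_nonneg h1 h2
      have h6 : t ≤ 4 * r := by linarith
      rcases hmj with ⟨rfl, rfl⟩ | ⟨rfl, rfl⟩
      · have h7 : t ^ 4 ≤ (4 * r) ^ 4 := pow_le_pow_left₀ h1.le h6 4
        have h8 : r⁻¹ ≤ 4 ^ 4 * (r ^ 3 * (t ^ 4)⁻¹) := by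
          rw [← div_eq_mul_inv, mul_div_assoc', le_div_iff₀ (by positivity),
            inv_mul_le_iff₀ h2]
          linarith
        calc r⁻¹ * (A t ^ 1 * (t ^ 0)⁻¹) = A t * r⁻¹ := by simp [mul_comm]
          _ ≤ A t * (4 ^ 4 * (r ^ 3 * (t ^ 4)⁻¹)) := by gcongr
          _ ≤ 4 ^ 4 * wTwo A t r := by rw [wTwo]; linarith [h4.2]
      · have h7 : t ^ 3 ≤ (4 * r) ^ 3 := pow_le_pow_left₀ h1.le h6 3
        have h8 : r⁻¹ * t⁻¹ ≤ 4 ^ 4 * (r ^ 2 * (t ^ 4)⁻¹) := by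
          rw [← mul_inv, inv_le_iff_one_le_mul₀ (by positivity)]
          have : 4 ^ 4 * (r ^ 2 * (t ^ 4)⁻¹) * (r * t) = 4 * ((4 * r) ^ 3 / t ^ 3) := by
            field_simp
          rw [this]
          have : 1 ≤ (4 * r) ^ 3 / t ^ 3 := by rwa [one_le_div (by positivity)]
          linarith
        calc r⁻¹ * (A t ^ 3 * (t ^ 1)⁻¹) = A t ^ 3 * (r⁻¹ * t⁻¹) := by rw [pow_one]; ring
          _ ≤ A t ^ 3 * (4 ^ 4 * (r ^ 2 * (t ^ 4)⁻¹)) := by gcongr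
          _ ≤ 4 ^ 4 * wTwo A t r := by rw [wTwo]; linarith [h4.1]
  have hle : ∀ (t r : ℝ), (t, r) ∈ outerCone → r * t⁻¹ ≤ 1 := fun t r hx => by
    have h1 := (hq hx).1
    have h2 := hx.2.2
    simp only at h1 h2
    rw [← div_eq_mul_inv, div_le_one h1]; exact h2.le
  have hA2 : Symb outerCone (fun t _ => A t ^ 1 * (t ^ 0)⁻¹) 2
      (fun t r => r ^ 2 * deriv (deriv A) t) := by
    refine (((Symb.snd hq).pow 2).mul (hA.symb_pow hq (m := 1) (j := 2)
      (hA.pow_deriv2.cast (by norm_num; ring)) 2)).mono_weight (fun t r hx => ?_)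
      ⟨1, fun t r hx => ?_⟩
    · have h1 := (hq hx).1
      have h3 := hA.pos h1
      simp only at h1 h3
      positivity
    · have h1 := (hq hx).1
      have h2 := (hq hx).2
      have h3 := hA.pos h1
      simp only at h1 h2 h3
      have h4 : (r * t⁻¹) ^ 2 ≤ 1 := pow_le_one₀ (by positivity) (hle t r hx)
      calc r ^ 2 * (A t ^ 1 * (t ^ 2)⁻¹) = A t * (r * t⁻¹) ^ 2 := by field_simp
        _ ≤ A t * 1 := by gcongr
        _ = _ := by simp
  have hK : Symb outerCone (fun t _ => A t ^ 3 * (t ^ 1)⁻¹) 2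
      (fun t r => 2 * r * (-(15 / 4 * Real.pi) * coefK A t)) := by
    refine (((Symb.snd hq).const_mul 2).mul ((hA.symb_coefK hq 2).const_mul
      (-(15 / 4 * Real.pi)))).mono_weight (fun t r hx => ?_)
      ⟨1, fun t r hx => ?_⟩
    · have h1 := (hq hx).1
      have h2 := (hq hx).2
      have h3 := hA.pos h1
      simp only at h1 h2 h3
      positivity
    · have h1 := (hq hx).1
      have h2 := (hq hx).2
      have h3 := hA.pos h1
      simp only at h1 h2 h3
      calc r * (A t ^ 3 * (t ^ 2)⁻¹) = A t ^ 3 * (t ^ 1)⁻¹ * (r * t⁻¹) := by field_simp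
        _ ≤ A t ^ 3 * (t ^ 1)⁻¹ * 1 := by gcongr; exact hle t r hx
        _ = _ := by ring
  have hto : ∀ (m j : ℕ) (q : ℝ) (F : ℝ → ℝ → ℝ), q = m * p - j →
      Symb lightCone (fun t _ => t ^ q) 2 F →
      Symb outerCone (fun t _ => A t ^ m * (t ^ j)⁻¹) 2 F := by
    rintro m j q F rfl hF
    refine (hF.mono_set outerCone_subset).mono_weight
      (fun t r hx => Real.rpow_nonneg (hq hx).1.le _) ?_
    obtain ⟨C, -, hC⟩ := hA.rpow_le m j
    exact ⟨C, fun t r hx => hC t (hq hx).1⟩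
  have hA0 := hto 1 0 p _ (by simp) (hA.pow.symb (φ := A) lightCone_subset 2)
  have hAp := hto 1 0 p _ (by simp) (hA.pow.symb_comp_add 2)
  have hAm := hto 1 0 p _ (by simp) (hA.pow.symb_comp_sub 2 (by push_cast; linarith))
  have hBp := hto 3 1 _ _ (by norm_num) ((hA.pow_primB hp).symb_comp_add 2)
  have hBm := hto 3 1 _ _ (by norm_num)
    ((hA.pow_primB hp).symb_comp_sub 2 (by push_cast; linarith))
  have h1 := hconv 1 0 _ (.inl ⟨rfl, rfl⟩) (((hA2.add (hA0.const_mul 2)).sub hAp).sub hAm)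
  have h2 := hconv 3 1 _ (.inr ⟨rfl, rfl⟩) ((hK.sub hBp).add hBm)
  refine ((h1.const_mul (-(Real.sqrt 3 / 2))).sub (h2.const_mul (1 / 2))).congr
    isOpen_outerCone fun t r _ => ?_
  rw [corrTwo, waveA, waveB]
  ring

theorem symb_corrTwo_lightCone (hA : Amp p A) (hp : 2 < p) :
    Symb lightCone (wTwo A) 2 (corrTwo A) := by
  rw [← innerCone_union_outerCone]
  refine Symb.union isOpen_innerCone isOpen_outerCone innerCone_subset
    (outerCone_subset.trans lightCone_subset) (fun t r hx => ?_) (hA.symb_corrTwo_inner hp 2)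
    (hA.symb_corrTwo_outer hp)
  rw [innerCone_union_outerCone] at hx
  have := hA.wTwo_terms_nonneg (lightCone_subset hx).1 (lightCone_subset hx).2
  exact add_nonneg this.1 this.2

end Amp

/-- `F` has second time derivative `d` on `Ω`. -/
def TimeOn (Ω : Set (ℝ × ℝ)) (F d : ℝ → ℝ → ℝ) : Prop :=
  ∃ F' : ℝ → ℝ → ℝ, ∀ t r, (t, r) ∈ Ω →
    HasDerivAt (fun s => F s r) (F' t r) t ∧ HasDerivAt (fun s => F' s r) (d t r) t

/-- `F` has radial Laplacian `d` on `Ω`. -/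
def SpaceOn (Ω : Set (ℝ × ℝ)) (F d : ℝ → ℝ → ℝ) : Prop :=
  ∃ F' F'' : ℝ → ℝ → ℝ, ∀ t r, (t, r) ∈ Ω →
    HasDerivAt (F t) (F' t r) r ∧ HasDerivAt (F' t) (F'' t r) r ∧ F'' t r + 2 / r * F' t r = d t r

section

variable {Ω : Set (ℝ × ℝ)} {F G d e : ℝ → ℝ → ℝ}

theorem TimeOn.add (hF : TimeOn Ω F d) (hG : TimeOn Ω G e) :
    TimeOn Ω (fun t r => F t r + G t r) (fun t r => d t r + e t r) := by
  obtain ⟨F', h⟩ := hF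
  obtain ⟨G', h'⟩ := hG
  exact ⟨fun t r => F' t r + G' t r, fun t r hx =>
    ⟨(h t r hx).1.add (h' t r hx).1, (h t r hx).2.add (h' t r hx).2⟩⟩

theorem SpaceOn.add (hF : SpaceOn Ω F d) (hG : SpaceOn Ω G e) :
    SpaceOn Ω (fun t r => F t r + G t r) (fun t r => d t r + e t r) := by
  obtain ⟨F', F'', h⟩ := hF
  obtain ⟨G', G'', h'⟩ := hG
  refine ⟨fun t r => F' t r + G' t r, fun t r => F'' t r + G'' t r, fun t r hx =>
    ⟨(h t r hx).1.add (h' t r hx).1, (h t r hx).2.1.add (h' t r hx).2.1, ?_⟩⟩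
  have h1 := (h t r hx).2.2
  have h2 := (h' t r hx).2.2
  simp only
  linear_combination h1 + h2

theorem err_eq_of_timeOn_spaceOn (ho : IsOpen Ω) (hF : TimeOn Ω F d) (hG : SpaceOn Ω F e)
    {t r : ℝ} (hx : (t, r) ∈ Ω) : err F t r = d t r - e t r - F t r ^ 5 := by
  obtain ⟨F', h⟩ := hF
  obtain ⟨G', G'', h'⟩ := hG
  have e1 : pd 2 0 F t r = d t r := by
    simp only [pd, iteratedDeriv_zero, iteratedDeriv_succ]
    have : deriv (fun s => F s r) =ᶠ[𝓝 t] fun s => F' s r := by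
      filter_upwards [(ho.preimage (by fun_prop : Continuous fun s : ℝ => (s, r))).mem_nhds hx]
        with s hs
      exact (h s r hs).1.deriv
    rw [this.deriv_eq]
    exact (h t r hx).2.deriv
  have e2 : pd 0 1 F t r = G' t r := by
    simp only [pd, iteratedDeriv_zero, iteratedDeriv_succ]
    exact (h' t r hx).1.deriv
  have e3 : pd 0 2 F t r = G'' t r := by
    simp only [pd, iteratedDeriv_zero, iteratedDeriv_succ]
    have : deriv (fun s => F t s) =ᶠ[𝓝 r] fun s => G' t s := by
      filter_upwards [(ho.preimage (by fun_prop : Continuous fun s : ℝ => (t, s))).mem_nhds hx]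
        with s hs
      exact (h' t s hs).1.deriv
    rw [this.deriv_eq]
    exact (h' t r hx).2.1.deriv
  rw [err, e1, e2, e3, ← (h' t r hx).2.2]
  ring

theorem TimeOn.of_symb (hF : Symb Ω G 2 F) (ho : IsOpen Ω) (hq : Ω ⊆ quadrant) :
    TimeOn Ω F (fun t r => deriv (fun s => deriv (fun s => F s r) s) t) :=
  ⟨fun t r => deriv (fun s => F s r) t, fun _ _ hx => ⟨Symb.hasDerivAt_fst (n := 1) hF hx,
    (Symb.deriv_fst (n := 1) ho hq hF).hasDerivAt_fst hx⟩⟩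

end

namespace Amp

variable {p : ℝ} {A : ℝ → ℝ}

/-- The second time derivative of the rescaled ground state. -/
def solUtt (A : ℝ → ℝ) (t r : ℝ) : ℝ :=
  (A t)⁻¹ ^ 3 * ((-2 * A t * deriv (deriv A) t - 2 * deriv A t ^ 2) * scalOne (scl A t r)
    + 4 * deriv A t ^ 2 * (scalOne (scl A t r) + scalTwo (scl A t r)))

theorem hasDerivAt_mul_comp_scl (hA : Amp p A) {c h : ℝ → ℝ} {t r c' h' : ℝ} (ht : 0 < t)
    (hc : HasDerivAt c c' t) (hh : HasDerivAt h h' (scl A t r)) :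
    HasDerivAt (fun s => c s * h (scl A s r))
      (c' * h (scl A t r) + c t * (h' * (-2 * (deriv A t * (A t)⁻¹) * scl A t r))) t :=
  hc.mul (hh.comp t (hA.hasDerivAt_scl_fst r ht))

theorem timeOn_solU (hA : Amp p A) : TimeOn lightCone (solU A) (solUtt A) := by
  refine ⟨fun t r => -2 * deriv A t * (A t)⁻¹ ^ 2 * scalOne (scl A t r), fun t r hx => ?_⟩
  have ht : 0 < t := (lightCone_subset hx).1
  have hp := (hA.pos ht).ne'
  have h1 := hA.pow.hasDerivAt ht
  have h2 := hA.pow_deriv.hasDerivAt ht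
  constructor
  · have e := hasDerivAt_jb_inv_scal (scl A t r)
    refine (hA.hasDerivAt_mul_comp_scl ht (h1.inv hp) e.1).congr_deriv ?_
    simp only [← e.2, Pi.inv_apply]
    field_simp
    ring
  · have e := hasDerivAt_scalOne (scl A t r)
    refine (hA.hasDerivAt_mul_comp_scl ht ((h2.const_mul (-2)).mul ((h1.inv hp).pow 2))
      e.1).congr_deriv ?_
    rw [solUtt, ← e.2]
    simp only [Pi.mul_apply, Pi.pow_apply, Pi.inv_apply, Nat.cast_ofNat, Nat.add_one_sub_one,
      pow_one]
    generalize (jb (scl A t r))⁻¹ ^ 3 * (-scl A t r - 3 * (scl A t r / (1 + scl A t r ^ 2)) *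
      ((1 - scl A t r ^ 2) / 2)) = X
    field_simp
    ring

theorem spaceOn_comp_scl (hA : Amp p A) {h h' h'' d c : ℝ → ℝ}
    (hh : ∀ y, 0 < y → HasDerivAt h (h' y) y ∧ HasDerivAt h' (h'' y) y ∧
      h'' y + 2 / y * h' y = d y) :
    SpaceOn lightCone (fun t r => c t * h (scl A t r))
      (fun t r => c t * ((A t)⁻¹ ^ 4 / 3 * d (scl A t r))) := by
  refine ⟨fun t r => c t * (h' (scl A t r) * (Real.sqrt 3 * A t ^ 2)⁻¹),
    fun t r => c t * (h'' (scl A t r) * (Real.sqrt 3 * A t ^ 2)⁻¹ * (Real.sqrt 3 * A t ^ 2)⁻¹),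
    fun t r hx => ?_⟩
  have ht : 0 < t := (lightCone_subset hx).1
  have hr : 0 < r := (lightCone_subset hx).2
  have hp := (hA.pos ht).ne'
  obtain ⟨e1, e2, e3⟩ := hh _ (hA.scl_pos ht hr)
  refine ⟨(e1.comp r (hasDerivAt_scl_snd t r)).const_mul (c t),
    ((e2.comp r (hasDerivAt_scl_snd t r)).mul_const _).const_mul (c t), ?_⟩
  have h3 : Real.sqrt 3 ^ 2 = 3 := Real.sq_sqrt (by norm_num)
  have h4 : (A t)⁻¹ ^ 4 / 3 = (Real.sqrt 3 * A t ^ 2)⁻¹ * (Real.sqrt 3 * A t ^ 2)⁻¹ := by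
    rw [← mul_inv, show Real.sqrt 3 * A t ^ 2 * (Real.sqrt 3 * A t ^ 2)
      = Real.sqrt 3 ^ 2 * A t ^ 4 by ring, h3, mul_inv]
    ring
  have h5 : 2 / r = 2 / scl A t r * (Real.sqrt 3 * A t ^ 2)⁻¹ := by
    rw [scl]; field_simp
  simp only
  rw [← e3, h4, h5]
  ring

theorem spaceOn_solU (hA : Amp p A) :
    SpaceOn lightCone (solU A) (fun t r => -solU A t r ^ 5) := by
  have key := hA.spaceOn_comp_scl (c := fun t => (A t)⁻¹) (h := fun y => (jb y)⁻¹)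
    (d := fun y => -3 * (jb y)⁻¹ ^ 5) fun y hy =>
    ⟨(hasDerivAt_jb_inv_scal y).1, hasDerivAt_jb_inv_deriv y, by
      have h1 := (jb_pos y).ne'
      have h2 := jb_sq y
      field_simp
      rw [h2]
      ring⟩
  have h : (fun t r => -solU A t r ^ 5) = fun t r =>
      (A t)⁻¹ * ((A t)⁻¹ ^ 4 / 3 * (-3 * (jb (scl A t r))⁻¹ ^ 5)) := by
    funext t r
    rw [solU]; ring
  rw [h]
  exact key

theorem spaceOn_corrOne (hA : Amp p A) :
    SpaceOn lightCone (corrOne A)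
      (fun t r => solUtt A t r - 5 * solU A t r ^ 4 * corrOne A t r) := by
  obtain ⟨f', f'', hf⟩ := linRadial_profOne
  obtain ⟨g', g'', hg⟩ := linRadial_profTwo
  have h1 := hA.spaceOn_comp_scl (c := fun t => -2 * coefK A t)
    (d := fun y => 3 * scalOne y - 15 * (jb y)⁻¹ ^ 4 * profOne y)
    fun y hy => ⟨(hf y hy).1, (hf y hy).2.1, by linear_combination (hf y hy).2.2⟩
  have h2 := hA.spaceOn_comp_scl (c := fun t => A t * deriv A t ^ 2)
    (d := fun y => 12 * (scalOne y + scalTwo y) - 15 * (jb y)⁻¹ ^ 4 * profTwo y)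
    fun y hy => ⟨(hg y hy).1, (hg y hy).2.1, by linear_combination (hg y hy).2.2⟩
  obtain ⟨F', F'', h⟩ := h1.add h2
  refine ⟨F', F'', fun t r hx => ⟨(h t r hx).1, (h t r hx).2.1, (h t r hx).2.2.trans ?_⟩⟩
  have hp := (hA.pos (lightCone_subset hx).1).ne'
  simp only at hp
  have hj := (jb_pos (scl A t r)).ne'
  simp only [solUtt, corrOne, solU, coefK]
  field_simp
  ring

/-- The limit of the first correction in the rescaled radius. -/
def limK (A : ℝ → ℝ) (t : ℝ) : ℝ := -(15 / 4 * Real.pi) * coefK A t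

theorem hasDerivAt_limK (hA : Amp p A) {t : ℝ} (ht : 0 < t) :
    HasDerivAt (limK A) (deriv (limK A) t) t ∧
      HasDerivAt (deriv (limK A)) (deriv (deriv (limK A)) t) t := by
  have h := hA.pow_coefK.const_mul (-(15 / 4 * Real.pi))
  exact ⟨h.hasDerivAt ht, h.deriv.hasDerivAt ht⟩

theorem timeOn_corrOne (hA : Amp p A) :
    TimeOn lightCone (corrOne A) (fun t r =>
      deriv (fun s => deriv (fun s => decayPart A s r) s) t +
      (Real.sqrt 3 / 2 * r * deriv (deriv (deriv (deriv A))) t + deriv (deriv (limK A)) t)) := by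
  have h1 := TimeOn.of_symb (hA.symb_decayPart lightCone_subset isOpen_lightCone 2)
    isOpen_lightCone lightCone_subset
  have h2 : TimeOn lightCone (fun t r => Real.sqrt 3 / 2 * r * deriv (deriv A) t + limK A t)
      (fun t r => Real.sqrt 3 / 2 * r * deriv (deriv (deriv (deriv A))) t +
        deriv (deriv (limK A)) t) := by
    refine ⟨fun t r => Real.sqrt 3 / 2 * r * deriv (deriv (deriv A)) t + deriv (limK A) t,
      fun t r hx => ?_⟩
    have ht : 0 < t := (lightCone_subset hx).1
    exact ⟨((hA.pow_deriv2.hasDerivAt ht).const_mul _).add (hA.hasDerivAt_limK ht).1,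
      ((hA.pow_deriv2.deriv.hasDerivAt ht).const_mul _).add (hA.hasDerivAt_limK ht).2⟩
  convert h1.add h2 using 3 with t r
  rw [decayPart, limK]
  ring

/-- The value of `∂ₜ²` on the second correction, up to the factor `1/r`. -/
def corrTwoTt (A : ℝ → ℝ) (t r : ℝ) : ℝ :=
  -(Real.sqrt 3 / 2) * (2 * deriv (deriv A) t - deriv (deriv A) (t + r) - deriv (deriv A) (t - r))
    - 1 / 2 * (- deriv (limK A) (t + r) + deriv (limK A) (t - r))

theorem timeOn_corrTwo (hA : Amp p A) (hp : 2 < p) :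
    TimeOn lightCone (corrTwo A) (fun t r => corrTwoTt A t r / r -
      (Real.sqrt 3 / 2 * r * deriv (deriv (deriv (deriv A))) t + deriv (deriv (limK A)) t)) := by
  refine ⟨fun t r => (-(Real.sqrt 3 / 2) * (r ^ 2 * deriv (deriv (deriv A)) t + 2 * deriv A t
    - deriv A (t + r) - deriv A (t - r)) - 1 / 2 * (2 * r * deriv (limK A) t
    - limK A (t + r) + limK A (t - r))) / r, fun t r hx => ?_⟩
  have ht : 0 < t := (lightCone_subset hx).1
  have hr : 0 < r := (lightCone_subset hx).2
  have ha : 0 < t + r := by linarith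
  have hs : 0 < t - r := by have := hx.2; simp only at this; linarith
  constructor
  · refine (((((((hA.pow_deriv2.hasDerivAt ht).const_mul (r ^ 2)).add
      ((hA.pow.hasDerivAt ht).const_mul 2)).sub
      ((hA.pow.hasDerivAt ha).comp_add_const t r)).sub
      ((hA.pow.hasDerivAt hs).comp_sub_const t r)).const_mul (-(Real.sqrt 3 / 2))).sub
      (((((hA.hasDerivAt_limK ht).1.const_mul (2 * r)).sub
      ((hA.hasDerivAt_primB hp (t + r)).comp_add_const t r)).add
      ((hA.hasDerivAt_primB hp (t - r)).comp_sub_const t r)).const_mul (1 / 2))).div_const r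
  · refine ((((((((hA.pow_deriv2.deriv.hasDerivAt ht).const_mul (r ^ 2)).add
      ((hA.pow_deriv.hasDerivAt ht).const_mul 2)).sub
      ((hA.pow_deriv.hasDerivAt ha).comp_add_const t r)).sub
      ((hA.pow_deriv.hasDerivAt hs).comp_sub_const t r)).const_mul (-(Real.sqrt 3 / 2))).sub
      (((((hA.hasDerivAt_limK ht).2.const_mul (2 * r)).sub
      ((hA.hasDerivAt_limK ha).1.comp_add_const t r)).add
      ((hA.hasDerivAt_limK hs).1.comp_sub_const t r)).const_mul (1 / 2))).div_const
      r).congr_deriv ?_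
    simp only [corrTwoTt]
    field_simp
    ring

theorem spaceOn_div {Ω : Set (ℝ × ℝ)} (hq : Ω ⊆ quadrant) {G G' G'' : ℝ → ℝ → ℝ}
    (h : ∀ t r, (t, r) ∈ Ω → HasDerivAt (G t) (G' t r) r ∧ HasDerivAt (G' t) (G'' t r) r) :
    SpaceOn Ω (fun t r => G t r / r) (fun t r => G'' t r / r) := by
  refine ⟨fun t r => G' t r / r - G t r / r ^ 2,
    fun t r => G'' t r / r - G' t r / r ^ 2 - (G' t r / r ^ 2 - 2 * G t r / r ^ 3),
    fun t r hx => ?_⟩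
  have hr : r ≠ 0 := (hq hx).2.ne'
  obtain ⟨h1, h2⟩ := h t r hx
  refine ⟨(h1.div (hasDerivAt_id' r) hr).congr_deriv ?_,
    ((h2.div (hasDerivAt_id' r) hr).sub
      (h1.div (hasDerivAt_pow 2 r) (pow_ne_zero 2 hr))).congr_deriv ?_, ?_⟩
  · field_simp
  · simp only [Nat.cast_ofNat, Nat.add_one_sub_one, pow_one]
    field_simp
  · simp only
    field_simp
    ring

theorem spaceOn_corrTwo (hA : Amp p A) (hp : 2 < p) :
    SpaceOn lightCone (corrTwo A) (fun t r => corrTwoTt A t r / r) := by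
  refine spaceOn_div lightCone_subset (G' := fun t r =>
    -(Real.sqrt 3 / 2) * (2 * r * deriv (deriv A) t - deriv A (t + r) + deriv A (t - r))
    - 1 / 2 * (2 * limK A t - limK A (t + r) - limK A (t - r))) fun t r hx => ?_
  have ht : 0 < t := (lightCone_subset hx).1
  have hr : 0 < r := (lightCone_subset hx).2
  have ha : 0 < t + r := by linarith
  have hs : 0 < t - r := by have := hx.2; simp only at this; linarith
  constructor
  · refine ((((((hasDerivAt_pow 2 r).mul_const (deriv (deriv A) t)).add_const (2 * A t)).sub
      ((hA.pow.hasDerivAt ha).comp_const_add t r)).sub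
      ((hA.pow.hasDerivAt hs).comp_const_sub t r)).const_mul (-(Real.sqrt 3 / 2))).sub
      ((((((hasDerivAt_id' r).const_mul 2).mul_const (limK A t)).sub
      ((hA.hasDerivAt_primB hp (t + r)).comp_const_add t r)).add
      ((hA.hasDerivAt_primB hp (t - r)).comp_const_sub t r)).const_mul (1 / 2)) |>.congr_deriv ?_
    simp only [Nat.cast_ofNat, Nat.add_one_sub_one, pow_one, limK]
    ring
  · refine ((((((hasDerivAt_id' r).const_mul 2).mul_const (deriv (deriv A) t)).sub
      ((hA.pow_deriv.hasDerivAt ha).comp_const_add t r)).add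
      ((hA.pow_deriv.hasDerivAt hs).comp_const_sub t r)).const_mul (-(Real.sqrt 3 / 2))).sub
      ((((hasDerivAt_const r (2 * limK A t)).sub
      ((hA.hasDerivAt_limK ha).1.comp_const_add t r)).sub
      ((hA.hasDerivAt_limK hs).1.comp_const_sub t r)).const_mul (1 / 2)) |>.congr_deriv ?_
    rw [corrTwoTt]
    ring

end Amp

/-- The approximate solution. -/
def approxSol (A : ℝ → ℝ) (t r : ℝ) : ℝ := solU A t r + (corrOne A t r + corrTwo A t r)

theorem Amp.err_approxSol {p : ℝ} {A : ℝ → ℝ} (hA : Amp p A) (hp : 2 < p) {t r : ℝ}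
    (hx : (t, r) ∈ lightCone) :
    err (approxSol A) t r = deriv (fun s => deriv (fun s => decayPart A s r) s) t
      - (5 * solU A t r ^ 4 * corrTwo A t r
        + 10 * solU A t r ^ 3 * (corrOne A t r + corrTwo A t r) ^ 2
        + 10 * solU A t r ^ 2 * (corrOne A t r + corrTwo A t r) ^ 3
        + 5 * solU A t r * (corrOne A t r + corrTwo A t r) ^ 4
        + (corrOne A t r + corrTwo A t r) ^ 5) := by
  have h := err_eq_of_timeOn_spaceOn isOpen_lightCone
    (hA.timeOn_solU.add (hA.timeOn_corrOne.add (hA.timeOn_corrTwo hp)))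
    (hA.spaceOn_solU.add (hA.spaceOn_corrOne.add (hA.spaceOn_corrTwo hp))) hx
  refine h.trans ?_
  ring

namespace Amp

variable {p : ℝ} {A : ℝ → ℝ} {Ω : Set (ℝ × ℝ)} {n : ℕ}

/-- The part of the cone with `t < 1`. -/
def shortCone : Set (ℝ × ℝ) := {x | x ∈ lightCone ∧ x.1 < 1}

/-- The weight of the difference between the approximate solution and the ground state. -/
def wDiff (A : ℝ → ℝ) (t r : ℝ) : ℝ := A t * (r * (t ^ 2)⁻¹)

/-- The weight of the error. -/
def wErr (A : ℝ → ℝ) (t r : ℝ) : ℝ :=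
  A t ^ 4 * (t ^ 2)⁻¹ * ((jb (scl A t r))⁻¹ * (1 + lg (scl A t r)))

theorem le_sq (hA : Amp p A) (hp : 2 < p) :
    ∃ C : ℝ, 0 ≤ C ∧ ∀ t, 0 < t → t < 1 → A t ≤ C * t ^ 2 := by
  obtain ⟨C, hC0, hC⟩ := hA.pow.bound
  refine ⟨C, hC0, fun t ht ht1 => ((le_abs_self _).trans (hC t ht)).trans ?_⟩
  have : t ^ p ≤ t ^ 2 := by
    rw [← Real.rpow_natCast]
    exact Real.rpow_le_rpow_of_exponent_ge ht ht1.le (by push_cast; linarith)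
  gcongr

theorem sq_le (hA : Amp p A) (hp : 2 < p) :
    ∃ C : ℝ, 0 ≤ C ∧ ∀ t, 0 < t → t < 1 → A t ^ 2 ≤ C * t := by
  obtain ⟨C, hC0, hC⟩ := hA.le_sq hp
  refine ⟨C ^ 2, by positivity, fun t ht ht1 => ?_⟩
  calc A t ^ 2 ≤ (C * t ^ 2) ^ 2 := pow_le_pow_left₀ (hA.pos ht).le (hC t ht ht1) 2
    _ = C ^ 2 * (t ^ 3 * t) := by ring
    _ ≤ C ^ 2 * (1 * t) := by gcongr; exact pow_le_one₀ ht.le ht1.le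
    _ = C ^ 2 * t := by ring

theorem symb_diff (hA : Amp p A) (hp : 2 < p) (hΩ : Ω ⊆ shortCone)
    (h2 : Symb Ω (wTwo A) n (corrTwo A)) :
    Symb Ω (wDiff A) n (fun t r => corrOne A t r + corrTwo A t r) := by
  have hq : Ω ⊆ quadrant := fun x hx => lightCone_subset (hΩ hx).1
  refine (hA.symb_corrOne hq n).add (h2.mono_weight (fun t r hx => ?_) ?_)
  · have := hA.wTwo_terms_nonneg (hq hx).1 (hq hx).2
    exact add_nonneg this.1 this.2
  · obtain ⟨C, hC0, hC⟩ := hA.sq_le hp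
    refine ⟨1 + C, fun t r hx => ?_⟩
    have ht : 0 < t := (hq hx).1
    have hr : 0 < r := (hq hx).2
    have hrt : r < t := (hΩ hx).1.2
    have ha := hA.pos ht
    have h1 : r * t⁻¹ ≤ 1 := by rw [← div_eq_mul_inv, div_le_one ht]; exact hrt.le
    have h0 : 0 ≤ r * t⁻¹ := by positivity
    have h3 : A t ^ 2 * t⁻¹ ≤ C := by
      rw [← div_eq_mul_inv, div_le_iff₀ ht]; exact hC t ht (hΩ hx).2
    calc wTwo A t r = A t * (r * (t ^ 2)⁻¹) * ((r * t⁻¹) ^ 2 + A t ^ 2 * t⁻¹ * (r * t⁻¹)) := by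
          rw [wTwo]; field_simp
      _ ≤ A t * (r * (t ^ 2)⁻¹) * (1 + C * 1) := by
          gcongr
          exact pow_le_one₀ h0 h1
      _ = (1 + C) * wDiff A t r := by rw [wDiff]; ring

theorem symb_solU (hA : Amp p A) (hq : Ω ⊆ quadrant) (n : ℕ) :
    Symb Ω (fun t r => (A t)⁻¹ * (jb (scl A t r))⁻¹) n (solU A) :=
  (hA.symb_inv hq n).mul (hA.symb_comp_scl hq symbOne_jb_inv n)

theorem symb_err (hA : Amp p A) (hp : 2 < p) (hΩ : Ω ⊆ shortCone) (ho : IsOpen Ω)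
    (h2 : Symb Ω (wTwo A) n (corrTwo A)) :
    Symb Ω (wErr A) n (fun t r => t ^ 2 * A t * err (approxSol A) t r) := by
  have hq : Ω ⊆ quadrant := fun x hx => lightCone_subset (hΩ hx).1
  have hv := hA.symb_diff hp hΩ h2
  have hu := hA.symb_solU hq n
  have hT := (Symb.fst (n := n) hq).pow 2 |>.mul (hA.symb hq n)
  set w := Real.sqrt 3 with hw
  have hw0 : 0 < w := by positivity
  have facts : ∀ t r, (t, r) ∈ Ω → 0 < t ∧ 0 < r ∧ 0 < A t ∧ r * t⁻¹ ≤ 1 ∧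
      0 < (jb (scl A t r))⁻¹ ∧ (jb (scl A t r))⁻¹ ≤ 1 ∧ 0 < scl A t r ∧
      (jb (scl A t r))⁻¹ * scl A t r ≤ 1 ∧ r = w * A t ^ 2 * scl A t r ∧ t < 1 ∧
      jb (scl A t r) ≤ 1 + scl A t r := by
    intro t r hx
    have ht : 0 < t := (hq hx).1
    have hr : 0 < r := (hq hx).2
    have ha := hA.pos ht
    have hrt : r < t := (hΩ hx).1.2
    have hy := hA.scl_pos ht hr
    have hj := jb_pos (scl A t r)
    refine ⟨ht, hr, ha, ?_, inv_pos.2 hj, jb_inv_le_one _, hy, ?_, ?_, (hΩ hx).2, ?_⟩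
    · rw [← div_eq_mul_inv, div_le_one ht]; exact hrt.le
    · rw [inv_mul_le_iff₀ hj, mul_one]; exact le_jb _
    · rw [scl, ← hw]
      have := ha.ne'
      field_simp
    · have := jb_sq (scl A t r)
      nlinarith
  have hfin : ∀ t r, (t, r) ∈ Ω → ∀ C, 0 ≤ C →
      A t ^ 4 * (t ^ 2)⁻¹ * (jb (scl A t r))⁻¹ * C ≤ C * wErr A t r := by
    intro t r hx C hC
    obtain ⟨ht, hr, ha, h1, hq0, hq1, hy, hqy, hry, ht1, hj⟩ := facts t r hx
    have := lg_nonneg (scl A t r)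
    calc A t ^ 4 * (t ^ 2)⁻¹ * (jb (scl A t r))⁻¹ * C
        = C * (A t ^ 4 * (t ^ 2)⁻¹ * ((jb (scl A t r))⁻¹ * 1)) := by ring
      _ ≤ C * (A t ^ 4 * (t ^ 2)⁻¹ * ((jb (scl A t r))⁻¹ * (1 + lg (scl A t r)))) := by
        gcongr; linarith
  have hpos : ∀ {X : ℝ → ℝ → ℝ}, (∀ t r, 0 < t → 0 < r → 0 < A t → 0 < (jb (scl A t r))⁻¹ →
      0 ≤ X t r) → ∀ t r, (t, r) ∈ Ω → 0 ≤ X t r := by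
    intro X hX t r hx
    obtain ⟨ht, hr, ha, h1, hq0, hq1, hy, hqy, hry, ht1, hj⟩ := facts t r hx
    exact hX t r ht hr ha hq0
  have T0 : Symb Ω (wErr A) n (fun t r =>
      t ^ 2 * A t * deriv (fun s => deriv (fun s => decayPart A s r) s) t) := by
    have h := hA.symb_decayPart hq ho (n + 2)
    refine (hT.mul (Symb.deriv_fst ho hq (Symb.deriv_fst (n := n + 1) ho hq h))).congr_weight
      fun t r hx => ?_
    obtain ⟨ht, hr, ha, h1, hq0, hq1, hy, hqy, hry, ht1, hj⟩ := facts t r hx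
    rw [wErr]; field_simp
  have T1 : Symb Ω (wErr A) n (fun t r => t ^ 2 * A t * (solU A t r ^ 4 * corrTwo A t r)) := by
    refine (hT.mul ((hu.pow 4).mul h2)).mono_weight
      (hpos fun t r ht hr ha hq0 => by rw [wTwo]; positivity) ⟨w ^ 3 + w ^ 2, fun t r hx => ?_⟩
    obtain ⟨ht, hr, ha, h1, hq0, hq1, hy, hqy, hry, ht1, hj⟩ := facts t r hx
    refine le_trans ?_ (hfin t r hx _ (by positivity))
    rw [wTwo]
    generalize (jb (scl A t r))⁻¹ = q at *
    generalize scl A t r = y at *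
    generalize A t = a at *
    subst hry
    calc _ = a ^ 4 * (t ^ 2)⁻¹ * q * (w ^ 3 * (q * y) ^ 3 + w ^ 2 * (q * (q * y) ^ 2)) := by
          field_simp
      _ ≤ a ^ 4 * (t ^ 2)⁻¹ * q * (w ^ 3 * 1 + w ^ 2 * (1 * 1)) := by
          gcongr
          · exact pow_le_one₀ (by positivity) hqy
          · exact pow_le_one₀ (by positivity) hqy
      _ = _ := by ring
  have T2 : Symb Ω (wErr A) n (fun t r => t ^ 2 * A t * (solU A t r ^ 3 *
      (corrOne A t r + corrTwo A t r) ^ 2)) := by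
    refine (hT.mul ((hu.pow 3).mul (hv.pow 2))).mono_weight
      (hpos fun t r ht hr ha hq0 => by rw [wDiff]; positivity) ⟨w ^ 2, fun t r hx => ?_⟩
    obtain ⟨ht, hr, ha, h1, hq0, hq1, hy, hqy, hry, ht1, hj⟩ := facts t r hx
    refine le_trans ?_ (hfin t r hx _ (by positivity))
    rw [wDiff]
    generalize (jb (scl A t r))⁻¹ = q at *
    generalize scl A t r = y at *
    generalize A t = a at *
    subst hry
    calc _ = a ^ 4 * (t ^ 2)⁻¹ * q * (w ^ 2 * (q * y) ^ 2) := by field_simp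
      _ ≤ a ^ 4 * (t ^ 2)⁻¹ * q * (w ^ 2 * 1) := by
          gcongr
          exact pow_le_one₀ (by positivity) hqy
      _ = _ := by ring
  have T3 : Symb Ω (wErr A) n (fun t r => t ^ 2 * A t * (solU A t r ^ 2 *
      (corrOne A t r + corrTwo A t r) ^ 3)) := by
    refine (hT.mul ((hu.pow 2).mul (hv.pow 3))).mono_weight
      (hpos fun t r ht hr ha hq0 => by rw [wDiff]; positivity) ⟨w, fun t r hx => ?_⟩
    obtain ⟨ht, hr, ha, h1, hq0, hq1, hy, hqy, hry, ht1, hj⟩ := facts t r hx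
    refine le_trans ?_ (hfin t r hx _ (by positivity))
    rw [wDiff]
    generalize (jb (scl A t r))⁻¹ = q at *
    generalize scl A t r = y at *
    generalize A t = a at *
    have h0 : 0 ≤ r * t⁻¹ := by positivity
    calc _ = a ^ 2 * (t ^ 2)⁻¹ * q ^ 2 * (r * t⁻¹) ^ 2 * r := by field_simp
      _ = a ^ 4 * (t ^ 2)⁻¹ * q * (w * ((q * y) * (r * t⁻¹) ^ 2)) := by
          linear_combination (a ^ 2 * (t ^ 2)⁻¹ * q ^ 2 * (r * t⁻¹) ^ 2) * hry
      _ ≤ a ^ 4 * (t ^ 2)⁻¹ * q * (w * (1 * 1)) := by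
          gcongr
          exact pow_le_one₀ h0 h1
      _ = _ := by ring
  have T4 : Symb Ω (wErr A) n (fun t r => t ^ 2 * A t * (solU A t r *
      (corrOne A t r + corrTwo A t r) ^ 4)) := by
    refine (hT.mul (hu.mul (hv.pow 4))).mono_weight
      (hpos fun t r ht hr ha hq0 => by rw [wDiff]; positivity) ⟨1, fun t r hx => ?_⟩
    obtain ⟨ht, hr, ha, h1, hq0, hq1, hy, hqy, hry, ht1, hj⟩ := facts t r hx
    refine le_trans ?_ (hfin t r hx _ (by positivity))
    rw [wDiff]
    have h0 : 0 ≤ r * t⁻¹ := by positivity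
    calc _ = A t ^ 4 * (t ^ 2)⁻¹ * (jb (scl A t r))⁻¹ * (r * t⁻¹) ^ 4 := by field_simp
      _ ≤ _ := by
          gcongr
          exact pow_le_one₀ h0 h1
  have T5 : Symb Ω (wErr A) n (fun t r => t ^ 2 * A t *
      (corrOne A t r + corrTwo A t r) ^ 5) := by
    obtain ⟨C, hC0, hC⟩ := hA.sq_le hp
    refine (hT.mul (hv.pow 5)).mono_weight
      (hpos fun t r ht hr ha hq0 => by rw [wDiff]; positivity) ⟨C + w⁻¹, fun t r hx => ?_⟩
    obtain ⟨ht, hr, ha, h1, hq0, hq1, hy, hqy, hry, ht1, hj⟩ := facts t r hx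
    refine le_trans ?_ (hfin t r hx _ (by positivity))
    rw [wDiff]
    have h0 : 0 ≤ r * t⁻¹ := by positivity
    have h3 : A t ^ 2 * t⁻¹ ≤ C := by
      rw [← div_eq_mul_inv, div_le_iff₀ ht]; exact hC t ht ht1
    have hjp := jb_pos (scl A t r)
    generalize jb (scl A t r) = q at *
    generalize scl A t r = y at *
    generalize A t = a at *
    calc _ = a ^ 4 * (t ^ 2)⁻¹ * q⁻¹ * (a ^ 2 * t⁻¹ * (r * t⁻¹) ^ 5 * q) := by field_simp
      _ ≤ a ^ 4 * (t ^ 2)⁻¹ * q⁻¹ * (a ^ 2 * t⁻¹ * (r * t⁻¹) ^ 5 * (1 + y)) := by gcongr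
      _ = a ^ 4 * (t ^ 2)⁻¹ * q⁻¹ * (a ^ 2 * t⁻¹ * (r * t⁻¹) ^ 5 +
            (r * t⁻¹) ^ 5 * t⁻¹ * w⁻¹ * (w * a ^ 2 * y)) := by field_simp
      _ = a ^ 4 * (t ^ 2)⁻¹ * q⁻¹ * (a ^ 2 * t⁻¹ * (r * t⁻¹) ^ 5 + (r * t⁻¹) ^ 6 * w⁻¹) := by
          rw [← hry]; ring
      _ ≤ a ^ 4 * (t ^ 2)⁻¹ * q⁻¹ * (C * 1 + 1 * w⁻¹) := by
          gcongr
          · exact pow_le_one₀ h0 h1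
          · exact pow_le_one₀ h0 h1
      _ = _ := by ring
  refine (T0.sub (((((T1.const_mul 5).add (T2.const_mul 10)).add (T3.const_mul 10)).add
    (T4.const_mul 5)).add T5)).congr ho fun t r hx => ?_
  rw [hA.err_approxSol hp (hΩ hx).1]
  ring

theorem wErr_le (hA : Amp p A) {t r : ℝ} (ht : 0 < t) (hr : 0 < r) :
    0 ≤ wErr A t r ∧ wErr A t r ≤ 12 * (A t ^ 4 * (t ^ 2)⁻¹ *
      (Real.log (Real.sqrt 3 * scl A t r + 2) / (Real.sqrt 3 * scl A t r + 1))) := by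
  have ha := hA.pos ht
  have hy := hA.scl_pos ht hr
  rw [wErr]
  generalize scl A t r = y at *
  have hl := lg_nonneg y
  have hj := jb_pos y
  refine ⟨by positivity, ?_⟩
  set R := Real.sqrt 3 * y with hR
  have h3 : Real.sqrt 3 ≤ 2 := by rw [Real.sqrt_le_left (by norm_num)]; norm_num
  have h3' : 1 ≤ Real.sqrt 3 := by rw [Real.one_le_sqrt]; norm_num
  have hyR : y ≤ R := by nlinarith
  have hR2 : R ≤ 2 * y := by nlinarith
  have l2 : (1 : ℝ) / 2 ≤ Real.log (R + 2) := by
    have := Real.log_two_gt_d9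
    have := Real.log_le_log (by norm_num : (0 : ℝ) < 2) (by linarith : 2 ≤ R + 2)
    linarith
  have l1 : lg y ≤ 2 * Real.log (R + 2) := by
    rw [lg, ← Real.log_rpow (by linarith)]
    refine Real.log_le_log (by positivity) ?_
    norm_num
    nlinarith
  have h1 : (jb y)⁻¹ * (R + 1) ≤ 3 := by
    rw [inv_mul_le_iff₀ hj]
    have := le_jb y
    have := one_le_jb y
    linarith
  calc A t ^ 4 * (t ^ 2)⁻¹ * ((jb y)⁻¹ * (1 + lg y))
      ≤ A t ^ 4 * (t ^ 2)⁻¹ * (3 / (R + 1) * (4 * Real.log (R + 2))) := by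
        gcongr
        · rw [le_div_iff₀ (by linarith)]; exact h1
        · linarith
    _ = _ := by ring

end Amp

/-- The region `r < t/2`, extended to negative radii. -/
def halfCone : Set (ℝ × ℝ) := {x | 0 < x.1 ∧ x.2 < x.1 / 2}

theorem isOpen_halfCone : IsOpen halfCone :=
  (isOpen_lt continuous_const continuous_fst).inter
    (isOpen_lt continuous_snd (continuous_fst.div_const 2))

theorem innerCone_subset_halfCone : innerCone ⊆ halfCone := fun _ hx =>
  ⟨(innerCone_subset hx).1, hx.2⟩

section

variable {F : ℝ → ℝ → ℝ} {k n : ℕ} {q C t : ℝ}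

theorem tendsto_flat_weight (hk : k ≠ 0) (ht : 0 < t) :
    Tendsto (fun x : ℝ × ℝ => C * (|x.2| ^ k * x.1 ^ q)) (𝓝 (t, 0)) (𝓝 0) := by
  have : ContinuousAt (fun x : ℝ × ℝ => C * (|x.2| ^ k * x.1 ^ q)) (t, 0) := by
    refine continuousAt_const.mul ((continuousAt_snd.abs.pow k).mul
      (continuousAt_fst.rpow_const (.inl ht.ne')))
  simpa [ContinuousAt, hk] using this

theorem abs_le_of_flat (hC0 : 0 ≤ C)
    (hC : ∀ t r, (t, r) ∈ innerCone → |F t r| ≤ C * (r ^ k * t ^ q))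
    (h0 : ∀ t r, r ≤ 0 → F t r = 0) {x : ℝ × ℝ} (hx : x ∈ halfCone) :
    |F x.1 x.2| ≤ C * (|x.2| ^ k * x.1 ^ q) := by
  rcases le_or_gt x.2 0 with h | h
  · rw [h0 _ _ h, abs_zero]
    have := Real.rpow_nonneg hx.1.le q
    positivity
  · rw [abs_of_pos h]
    exact hC _ _ ⟨h, hx.2⟩

theorem hasFDerivAt_flat (hk : k ≠ 0) (hC0 : 0 ≤ C)
    (hC : ∀ t r, (t, r) ∈ innerCone → |F t r| ≤ C * (r ^ (k + 1) * t ^ q))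
    (h0 : ∀ t r, r ≤ 0 → F t r = 0) (ht : 0 < t) :
    HasFDerivAt (fun x : ℝ × ℝ => F x.1 x.2) (0 : ℝ × ℝ →L[ℝ] ℝ) (t, 0) := by
  have hx : ((t, 0) : ℝ × ℝ) ∈ halfCone := ⟨ht, by simp only; linarith⟩
  rw [hasFDerivAt_iff_isLittleO]
  have h1 : (fun x : ℝ × ℝ => F x.1 x.2 - F t 0 - (0 : ℝ × ℝ →L[ℝ] ℝ) (x - (t, 0)))
      =O[𝓝 (t, 0)] fun x => (C * (|x.2| ^ k * x.1 ^ q)) * x.2 := by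
    refine Asymptotics.IsBigO.of_bound 1 ?_
    filter_upwards [isOpen_halfCone.mem_nhds hx] with x hx
    have := abs_le_of_flat hC0 hC h0 hx
    have h2 := Real.rpow_nonneg hx.1.le q
    rw [h0 t 0 le_rfl]
    simp only [sub_zero, zero_apply, norm_mul, norm_pow, Real.norm_eq_abs,
      abs_abs, one_mul]
    rw [abs_of_nonneg hC0, abs_of_nonneg h2]
    exact this.trans (le_of_eq (by ring))
  refine h1.trans_isLittleO ?_
  have h2 : (fun x : ℝ × ℝ => x.2) =O[𝓝 (t, 0)] fun x => x - (t, 0) := by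
    refine Asymptotics.IsBigO.of_bound 1 (Eventually.of_forall fun x => ?_)
    have := norm_snd_le (x - (t, 0))
    simpa using this
  have := ((Asymptotics.isLittleO_one_iff ℝ).2
    (tendsto_flat_weight (C := C) (q := q) hk ht)).mul_isBigO h2.norm_right
  simp only [one_mul] at this
  exact this.of_norm_right

/-- A symbol that vanishes to high order at the axis extends smoothly by zero. -/
theorem contDiffOn_flat (hk : n < k) (hF : Symb innerCone (fun t r => r ^ k * t ^ q) n F)
    (hsm : ContDiffOn ℝ n (fun x : ℝ × ℝ => F x.1 x.2) innerCone)
    (h0 : ∀ t r, r ≤ 0 → F t r = 0) :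
    ContDiffOn ℝ n (fun x : ℝ × ℝ => F x.1 x.2) halfCone := by
  induction n generalizing F k q with
  | zero =>
    obtain ⟨C, hC0, hC⟩ := hF.bound_nonneg fun t r hx =>
      mul_nonneg (pow_nonneg hx.1.le _) (Real.rpow_nonneg (innerCone_subset hx).1.le _)
    refine contDiffOn_zero.2 fun x hx => ContinuousAt.continuousWithinAt ?_
    rcases lt_trichotomy x.2 0 with h | h | h
    · refine (continuousAt_const (y := (0 : ℝ))).congr ?_
      filter_upwards [(isOpen_lt continuous_snd continuous_const).mem_nhds h] with y hy
      exact (h0 _ _ (le_of_lt hy)).symm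
    · obtain ⟨t, r⟩ := x
      obtain rfl : r = 0 := h
      rw [ContinuousAt, h0 t 0 le_rfl]
      refine squeeze_zero_norm' ?_ (tendsto_flat_weight (C := C) (q := q) hk.ne' hx.1)
      filter_upwards [isOpen_halfCone.mem_nhds hx] with y hy
      exact abs_le_of_flat hC0 hC h0 hy
    · exact hsm.continuousOn.continuousAt (isOpen_innerCone.mem_nhds ⟨h, hx.2⟩)
  | succ n ih =>
    obtain ⟨k, rfl⟩ : ∃ m, k = m + 1 := ⟨k - 1, by omega⟩
    obtain ⟨C, hC0, hC⟩ := hF.bound_nonneg fun t r hx =>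
      mul_nonneg (pow_nonneg hx.1.le _) (Real.rpow_nonneg (innerCone_subset hx).1.le _)
    have hd : ∀ x ∈ halfCone, DifferentiableAt ℝ (fun x : ℝ × ℝ => F x.1 x.2) x ∧
        (x.2 ≤ 0 → fderiv ℝ (fun x : ℝ × ℝ => F x.1 x.2) x = 0) := by
      intro x hx
      have neg : x.2 ≤ 0 → HasFDerivAt (fun x : ℝ × ℝ => F x.1 x.2) (0 : ℝ × ℝ →L[ℝ] ℝ) x := by
        intro h
        rcases h.lt_or_eq with h | h
        · refine (hasFDerivAt_const (0 : ℝ) x).congr_of_eventuallyEq ?_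
          filter_upwards [(isOpen_lt continuous_snd continuous_const).mem_nhds h] with y hy
          exact h0 _ _ (le_of_lt hy)
        · obtain ⟨t, r⟩ := x
          obtain rfl : r = 0 := h
          exact hasFDerivAt_flat (by omega) hC0 hC h0 hx.1
      refine ⟨?_, fun h => (neg h).fderiv⟩
      rcases le_or_gt x.2 0 with h | h
      · exact (neg h).differentiableAt
      · exact (hsm.contDiffAt (isOpen_innerCone.mem_nhds ⟨h, hx.2⟩)).differentiableAt
          (by simp)
    have hp : ∀ x ∈ halfCone, fderiv ℝ (fun x : ℝ × ℝ => F x.1 x.2) x (1, 0) =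
        deriv (fun s => F s x.2) x.1 ∧ fderiv ℝ (fun x : ℝ × ℝ => F x.1 x.2) x (0, 1) =
        deriv (F x.1) x.2 := by
      intro x hx
      have h := (hd x hx).1.hasFDerivAt
      constructor
      · exact (HasFDerivAt.comp_hasDerivAt x.1 (f := fun s => (s, x.2)) h
          ((hasDerivAt_id' x.1).prodMk (hasDerivAt_const _ _))).deriv.symm
      · exact (HasFDerivAt.comp_hasDerivAt x.2 (f := fun s => (x.1, s)) h
          ((hasDerivAt_const _ _).prodMk (hasDerivAt_id' x.2))).deriv.symm
    have hsm' := hsm.fderiv_of_isOpen (m := n) isOpen_innerCone (by push_cast; rfl)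
    have i1 := ih (F := fun t r => if 0 < r then deriv (fun s => F s r) t else 0) (k := k + 1)
      (q := q - 1) (by omega)
      (((hF.deriv_fst isOpen_innerCone innerCone_subset).congr_weight fun t r hx => by
        rw [Real.rpow_sub_one (innerCone_subset hx).1.ne', mul_assoc]; rfl).congr
        isOpen_innerCone fun t r hx => by rw [if_pos hx.1])
      ((hsm'.clm_apply contDiffOn_const).congr fun x hx => by
        rw [(hp x (innerCone_subset_halfCone hx)).1, if_pos hx.1])
      fun t r hr => if_neg hr.not_gt
    have i2 := ih (F := fun t r => if 0 < r then deriv (F t) r else 0) (k := k)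
      (q := q) (by omega)
      (((hF.deriv_snd isOpen_innerCone innerCone_subset).congr_weight fun t r hx => by
        have : r ≠ 0 := hx.1.ne'
        field_simp
        ring).congr isOpen_innerCone fun t r hx => by rw [if_pos hx.1])
      ((hsm'.clm_apply contDiffOn_const).congr fun x hx => by
        rw [(hp x (innerCone_subset_halfCone hx)).2, if_pos hx.1])
      fun t r hr => if_neg hr.not_gt
    push_cast
    rw [contDiffOn_succ_iff_fderiv_of_isOpen isOpen_halfCone]
    refine ⟨fun x hx => (hd x hx).1.differentiableWithinAt, fun h => by simp at h, ?_⟩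
    refine ((i1.smul (contDiffOn_const (c := ContinuousLinearMap.fst ℝ ℝ ℝ))).add
      (i2.smul (contDiffOn_const (c := ContinuousLinearMap.snd ℝ ℝ ℝ)))).congr fun x hx => ?_
    ext
    · rcases le_or_gt x.2 0 with h | h
      · rw [(hd x hx).2 h]; simp [h.not_gt]
      · simp [h, (hp x hx).1]
    · rcases le_or_gt x.2 0 with h | h
      · rw [(hd x hx).2 h]; simp [h.not_gt]
      · simp [h, (hp x hx).2]

end

/-- The fourth order Taylor remainder divided by the radius, extended by zero. -/
def flatTerm (f : ℝ → ℝ) (σ t r : ℝ) : ℝ := if 0 < r then r⁻¹ * taylorRem 4 f t (σ * r) else 0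

theorem PowSymb.contDiffOn_flatTerm {q : ℝ} {f : ℝ → ℝ} (hf : PowSymb q f) {σ : ℝ}
    (hσ : σ = 1 ∨ σ = -1) :
    ContDiffOn ℝ 2 (fun x : ℝ × ℝ => flatTerm f σ x.1 x.2) halfCone := by
  have hσ' : |σ| = 1 := by rcases hσ with rfl | rfl <;> simp
  refine contDiffOn_flat (n := 2) (k := 3) (q := q - 4) (by norm_num) ?_ ?_
    fun t r hr => if_neg hr.not_gt
  · refine (((Symb.snd_inv innerCone_subset).mul (hf.symb_taylorRem 4 2 hσ')).congr_weight
      fun t r hx => ?_).congr isOpen_innerCone fun t r hx => by rw [flatTerm, if_pos hx.1]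
    have : r ≠ 0 := hx.1.ne'
    push_cast
    field_simp
  · have hfst : ContDiffOn ℝ 2 (fun x : ℝ × ℝ => x.1) innerCone := contDiff_fst.contDiffOn
    have hsnd : ContDiffOn ℝ 2 (fun x : ℝ × ℝ => x.2) innerCone := contDiff_snd.contDiffOn
    have h1 : ContDiffOn ℝ 2 (fun x : ℝ × ℝ => f (x.1 + σ * x.2)) innerCone := by
      refine (hf.contDiffOn 2).comp (hfst.add (contDiffOn_const.mul hsnd)) fun x hx => ?_
      have h2 := hx.1
      have h3 := hx.2
      simp only [mem_Ioi]
      rcases hσ with rfl | rfl <;> linarith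
    have h2 : ∀ j : ℕ, ContDiffOn ℝ 2 (fun x : ℝ × ℝ => _root_.iteratedDeriv j f x.1) innerCone :=
      fun j => ((hf.iteratedDeriv j).contDiffOn 2).comp hfst fun x hx => (innerCone_subset hx).1
    have h3 : ContDiffOn ℝ 2 (fun x : ℝ × ℝ => x.2⁻¹ * (f (x.1 + σ * x.2) -
        ∑ j ∈ Finset.range 4,
          (σ * x.2) ^ j / j.factorial * _root_.iteratedDeriv j f x.1)) innerCone :=
      (hsnd.inv fun x hx => hx.1.ne').mul (h1.sub (ContDiffOn.sum fun j _ =>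
        (((contDiffOn_const.mul hsnd).pow j).div_const _).mul (h2 j)))
    exact h3.congr fun x hx => by rw [flatTerm, if_pos hx.1, taylorRem]

namespace Amp

variable {p : ℝ} {A : ℝ → ℝ}

theorem corrTwo_eq (hA : Amp p A) (hp : 2 < p) {t r : ℝ} (hr : 0 ≤ r) :
    corrTwo A t r = Real.sqrt 3 / 2 * (flatTerm A 1 t r + flatTerm A (-1) t r)
      + 1 / 2 * (flatTerm (primB A) 1 t r - flatTerm (primB A) (-1) t r)
      + r ^ 2 / 6 * iteratedDeriv 3 (primB A) t := by
  rcases hr.eq_or_lt with rfl | hr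
  · simp [corrTwo, flatTerm]
  · have h : ∀ s, taylorRem 4 (primB A) t s =
        taylorRem 3 (primB A) t s - s ^ 3 / 6 * iteratedDeriv 3 (primB A) t := fun s => by
      rw [taylorRem, Finset.sum_range_succ, taylorRem]
      norm_num [Nat.factorial]
      ring
    simp only [flatTerm, if_pos hr, corrTwo, waveA_eq A, hA.waveB_eq hp, h]
    field_simp
    ring

theorem contDiffOn_corrTwo (hA : Amp p A) (hp : 2 < p) :
    ContDiffOn ℝ 2 (fun x : ℝ × ℝ => corrTwo A x.1 x.2) {x | 0 < x.1 ∧ 0 ≤ x.2} := by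
  have hAc : ContDiff ℝ 2 A := hA.pow.contDiff 2 (by exact_mod_cast hp) hA.nonpos
  have hBc : ContDiff ℝ 2 (primB A) :=
    (hA.pow_primB hp).contDiff 2 (by push_cast; linarith) fun t ht => hA.primB_nonpos ht
  intro x hx
  rcases hx.2.eq_or_lt with h | h
  · have key : ContDiffOn ℝ 2 (fun x : ℝ × ℝ => Real.sqrt 3 / 2 * (flatTerm A 1 x.1 x.2
        + flatTerm A (-1) x.1 x.2) + 1 / 2 * (flatTerm (primB A) 1 x.1 x.2
        - flatTerm (primB A) (-1) x.1 x.2) + x.2 ^ 2 / 6 * iteratedDeriv 3 (primB A) x.1)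
        halfCone := by
      have hB := hA.pow_primB hp
      exact ((contDiffOn_const.mul ((hA.pow.contDiffOn_flatTerm (.inl rfl)).add
        (hA.pow.contDiffOn_flatTerm (.inr rfl)))).add (contDiffOn_const.mul
        ((hB.contDiffOn_flatTerm (.inl rfl)).sub (hB.contDiffOn_flatTerm (.inr rfl))))).add
        (((contDiff_snd.contDiffOn.pow 2).div_const 6).mul
        (((hB.iteratedDeriv 3).contDiffOn 2).comp contDiff_fst.contDiffOn fun x hx => hx.1))
    have hx' : x ∈ halfCone := ⟨hx.1, by have := hx.1; linarith⟩
    exact (key.contDiffAt (isOpen_halfCone.mem_nhds hx')).contDiffWithinAt.congr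
      (fun y hy => hA.corrTwo_eq hp hy.2) (hA.corrTwo_eq hp hx.2)
  · have hA2 : ContDiffAt ℝ 2 (fun x : ℝ × ℝ => deriv (deriv A) x.1) x :=
      ((hA.pow_deriv2.contDiffOn 2).contDiffAt (Ioi_mem_nhds hx.1)).comp x contDiffAt_fst
    have hK : ContDiffAt ℝ 2 (fun x : ℝ × ℝ => coefK A x.1) x :=
      ((hA.pow_coefK.contDiffOn 2).contDiffAt (Ioi_mem_nhds hx.1)).comp x contDiffAt_fst
    have hr : x.2 ≠ 0 := h.ne'
    refine ContDiffAt.contDiffWithinAt ?_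
    unfold corrTwo waveA waveB
    exact ContDiffAt.div (by fun_prop) contDiffAt_snd hr

theorem contDiffOn_approxSol (hA : Amp p A) (hp : 2 < p) :
    ContDiffOn ℝ 2 (fun x : ℝ × ℝ => approxSol A x.1 x.2) {x | 0 < x.1 ∧ 0 ≤ x.2} := by
  set S : Set (ℝ × ℝ) := {x | 0 < x.1 ∧ 0 ≤ x.2}
  have hfst : ∀ {f : ℝ → ℝ} {q : ℝ}, PowSymb q f → ContDiffOn ℝ 2 (fun x : ℝ × ℝ => f x.1) S :=
    fun hf => (hf.contDiffOn 2).comp contDiff_fst.contDiffOn fun x hx => hx.1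
  have h0 := hfst hA.pow
  have h1 := hfst hA.pow_deriv
  have hK := hfst hA.pow_coefK
  have hs : ContDiffOn ℝ 2 (fun x : ℝ × ℝ => scl A x.1 x.2) S :=
    contDiff_snd.contDiffOn.div (contDiffOn_const.mul (h0.pow 2)) fun x hx =>
      mul_ne_zero (by positivity) (pow_ne_zero 2 (hA.pos hx.1).ne')
  have hu : ContDiffOn ℝ 2 (fun x : ℝ × ℝ => solU A x.1 x.2) S :=
    (h0.inv fun x hx => (hA.pos hx.1).ne').mul (contDiff_jb_inv.comp_contDiffOn hs)
  have hv : ContDiffOn ℝ 2 (fun x : ℝ × ℝ => corrOne A x.1 x.2) S :=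
    ((contDiffOn_const.mul hK).mul ((contDiff_profOne 2).comp_contDiffOn hs)).add
      ((h0.mul (h1.pow 2)).mul ((contDiff_profTwo 2).comp_contDiffOn hs))
  exact hu.add (hv.add (hA.contDiffOn_corrTwo hp))

end Amp

theorem amp_ampl (p e : ℝ) : Amp p (ampl p e) where
  pow := pow_ampl p e
  low := ⟨Real.exp (-|e|), Real.exp_pos _, fun _ ht => le_ampl ht⟩
  nonpos _ ht := ampl_of_nonpos ht

section

variable (ν ε₀ : ℝ) {t : ℝ}

local notation "Λ" => ampl ((1 + ν) / 2) (ε₀ / 2)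

theorem lam_eq_ampl (ht : 0 < t) : lam ν ε₀ t = (Λ t)⁻¹ ^ 2 := by
  rw [lam, ampl_of_pos ht, mul_inv, mul_pow, ← Real.exp_neg, ← Real.exp_nat_mul,
    ← Real.rpow_neg ht.le, ← Real.rpow_mul_natCast ht.le]
  congr 2
  · push_cast; ring
  · push_cast; ring

theorem lam_rpow_half (ht : 0 < t) : lam ν ε₀ t ^ ((1 : ℝ) / 2) = (Λ t)⁻¹ := by
  rw [lam_eq_ampl ν ε₀ ht, ← Real.sqrt_eq_rpow,
    Real.sqrt_sq (inv_pos.2 ((amp_ampl _ _).pos ht)).le]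

theorem lam_rpow_neg_half (ht : 0 < t) : lam ν ε₀ t ^ (-(1 : ℝ) / 2) = Λ t := by
  have : 0 ≤ lam ν ε₀ t := by rw [lam_eq_ampl ν ε₀ ht]; positivity
  rw [neg_div, Real.rpow_neg this, lam_rpow_half ν ε₀ ht, inv_inv]

theorem mu_sq_inv (ht : 0 < t) : ((mu ν ε₀ t) ^ 2)⁻¹ = Λ t ^ 4 * (t ^ 2)⁻¹ := by
  rw [mu, lam_eq_ampl ν ε₀ ht]
  have := ((amp_ampl ((1 + ν) / 2) (ε₀ / 2)).pos ht).ne'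
  field_simp

theorem radius_eq (ht : 0 < t) (r : ℝ) : r * lam ν ε₀ t = Real.sqrt 3 * scl Λ t r := by
  rw [lam_eq_ampl ν ε₀ ht, scl]
  have := ((amp_ampl ((1 + ν) / 2) (ε₀ / 2)).pos ht).ne'
  field_simp

theorem W_eq_jb_inv (y : ℝ) : W (Real.sqrt 3 * y) = (jb y)⁻¹ := by
  have h : 1 + (Real.sqrt 3 * y) ^ 2 / 3 = 1 + y ^ 2 := by
    rw [mul_pow, Real.sq_sqrt (by norm_num)]; ring
  rw [W, h, neg_div, Real.rpow_neg (by positivity), ← Real.sqrt_eq_rpow, jb]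

theorem bulkDiff_approxSol (ht : 0 < t) (r : ℝ) :
    bulkDiff ν ε₀ (approxSol Λ) t r = corrOne Λ t r + corrTwo Λ t r := by
  rw [bulkDiff, lam_rpow_half ν ε₀ ht, radius_eq ν ε₀ ht, W_eq_jb_inv, approxSol, solU]
  ring

theorem pd_bounds (hν : 3 < ν) {Ω : Set (ℝ × ℝ)} (ho : IsOpen Ω) (hΩ : Ω ⊆ Amp.shortCone)
    {n k j : ℕ} (hn : k + j ≤ n) (h2 : Symb Ω (Amp.wTwo Λ) n (corrTwo Λ)) :
    ∃ C : ℝ, ∀ t r : ℝ, (t, r) ∈ Ω →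
        |pd k j (bulkDiff ν ε₀ (approxSol Λ)) t r|
            ≤ C * (t ^ k)⁻¹ * (r ^ j)⁻¹ *
                ((lam ν ε₀ t) ^ ((1 : ℝ) / 2) * ((mu ν ε₀ t) ^ 2)⁻¹ * (r * lam ν ε₀ t)) ∧
        |pd k j (renErr ν ε₀ (approxSol Λ)) t r|
            ≤ C * (t ^ k)⁻¹ * (r ^ j)⁻¹ *
                (((mu ν ε₀ t) ^ 2)⁻¹ *
                  (Real.log (r * lam ν ε₀ t + 2) / (r * lam ν ε₀ t + 1))) := by
  have hA := amp_ampl ((1 + ν) / 2) (ε₀ / 2)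
  have hp : 2 < (1 + ν) / 2 := by linarith
  have hq : Ω ⊆ quadrant := fun x hx => lightCone_subset (hΩ hx).1
  have h2' : Symb Ω (Amp.wTwo Λ) (0 + k + j) (corrTwo Λ) := h2.of_le (by omega)
  have s1 := (hA.symb_diff hp hΩ h2').congr ho (G := bulkDiff ν ε₀ (approxSol Λ))
    fun t r hx => (bulkDiff_approxSol ν ε₀ (hq hx).1 r).symm
  have s2 := (hA.symb_err hp hΩ ho h2').congr ho (G := renErr ν ε₀ (approxSol Λ))
    fun t r hx => by rw [renErr, lam_rpow_neg_half ν ε₀ (hq hx).1]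
  obtain ⟨C₁, hC₁⟩ := (Symb.pd ho hq k j s1).bound
  obtain ⟨C₂, hC₂0, hC₂⟩ := (Symb.pd ho hq k j s2).bound_nonneg fun t r hx => by
    have h1 : 0 < t := (hq hx).1
    have h2 : 0 < r := (hq hx).2
    have := (hA.wErr_le h1 h2).1
    positivity
  refine ⟨max C₁ (C₂ * 12), fun t r hx => ?_⟩
  have ht : 0 < t := (hq hx).1
  have hr : 0 < r := (hq hx).2
  have ha := hA.pos ht
  have hy := hA.scl_pos ht hr
  rw [lam_rpow_half ν ε₀ ht, mu_sq_inv ν ε₀ ht]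
  constructor
  · refine (hC₁ t r hx).trans ?_
    have e : Λ t * (r * (t ^ 2)⁻¹) = (Λ t)⁻¹ * (Λ t ^ 4 * (t ^ 2)⁻¹) * (r * lam ν ε₀ t) := by
      rw [lam_eq_ampl ν ε₀ ht]
      field_simp
    rw [Amp.wDiff, ← e]
    calc C₁ * ((t ^ k)⁻¹ * (r ^ j)⁻¹ * (Λ t * (r * (t ^ 2)⁻¹)))
        = C₁ * (t ^ k)⁻¹ * (r ^ j)⁻¹ * (Λ t * (r * (t ^ 2)⁻¹)) := by ring
      _ ≤ _ := by gcongr; exact le_max_left _ _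
  · refine (hC₂ t r hx).trans ?_
    have h3 := (hA.wErr_le ht hr).2
    rw [radius_eq ν ε₀ ht]
    have hR : 0 < Real.sqrt 3 * scl Λ t r := by positivity
    have hlog : 0 ≤ Real.log (Real.sqrt 3 * scl Λ t r + 2) := Real.log_nonneg (by linarith)
    generalize Real.sqrt 3 * scl Λ t r = R at *
    calc C₂ * ((t ^ k)⁻¹ * (r ^ j)⁻¹ * Amp.wErr Λ t r)
        ≤ C₂ * ((t ^ k)⁻¹ * (r ^ j)⁻¹ * (12 * (Λ t ^ 4 * (t ^ 2)⁻¹ *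
          (Real.log (R + 2) / (R + 1))))) := by gcongr
      _ = C₂ * 12 * (t ^ k)⁻¹ * (r ^ j)⁻¹ * (Λ t ^ 4 * (t ^ 2)⁻¹ *
          (Real.log (R + 2) / (R + 1))) := by ring
      _ ≤ _ := by gcongr; exact le_max_right _ _

end

/-- existence of the two-step approximate solution `u₂` with its error bounds. -/
theorem stmt2 (ν : ℝ) (hν : 3 < ν) :
    ∃ εstar > (0 : ℝ), ∀ ε₀ : ℝ, |ε₀| < εstar →
    ∃ t₀ ∈ Set.Ioo (0 : ℝ) (1 / 2), ∃ u₂ : ℝ → ℝ → ℝ,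
      -- u₂ ∈ C²({0 < t < t₀, 0 ≤ r ≤ t})
      ContDiffOn ℝ 2 (fun p : ℝ × ℝ => u₂ p.1 p.2)
        {p : ℝ × ℝ | 0 < p.1 ∧ p.1 < t₀ ∧ 0 ≤ p.2 ∧ p.2 ≤ p.1} ∧
      -- (i) bounds on u₂ and on the error e₂ inside the cone
      (∃ C : ℝ, ∀ t r : ℝ, 0 < t → t < t₀ → 0 < r → r < t →
        |bulkDiff ν ε₀ u₂ t r|
            ≤ C * (lam ν ε₀ t) ^ ((1 : ℝ) / 2) * ((mu ν ε₀ t) ^ 2)⁻¹ * (r * lam ν ε₀ t) ∧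
        |renErr ν ε₀ u₂ t r|
            ≤ C * ((mu ν ε₀ t) ^ 2)⁻¹ *
                (Real.log (r * lam ν ε₀ t + 2) / (r * lam ν ε₀ t + 1))) ∧
      -- (ii) derivative bounds, all orders, for 0 < r < t/2
      (∀ k j : ℕ, ∃ C : ℝ, ∀ t r : ℝ, 0 < t → t < t₀ → 0 < r → r < t / 2 →
        |pd k j (bulkDiff ν ε₀ u₂) t r|
            ≤ C * (t ^ k)⁻¹ * (r ^ j)⁻¹ *
                ((lam ν ε₀ t) ^ ((1 : ℝ) / 2) * ((mu ν ε₀ t) ^ 2)⁻¹ * (r * lam ν ε₀ t)) ∧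
        |pd k j (renErr ν ε₀ u₂) t r|
            ≤ C * (t ^ k)⁻¹ * (r ^ j)⁻¹ *
                (((mu ν ε₀ t) ^ 2)⁻¹ *
                  (Real.log (r * lam ν ε₀ t + 2) / (r * lam ν ε₀ t + 1)))) ∧
      -- (ii') the same bounds on the whole cone 0 < r < t when k + j ≤ 2
      (∀ k j : ℕ, k + j ≤ 2 → ∃ C : ℝ, ∀ t r : ℝ, 0 < t → t < t₀ → 0 < r → r < t →
        |pd k j (bulkDiff ν ε₀ u₂) t r|
            ≤ C * (t ^ k)⁻¹ * (r ^ j)⁻¹ *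
                ((lam ν ε₀ t) ^ ((1 : ℝ) / 2) * ((mu ν ε₀ t) ^ 2)⁻¹ * (r * lam ν ε₀ t)) ∧
        |pd k j (renErr ν ε₀ u₂) t r|
            ≤ C * (t ^ k)⁻¹ * (r ^ j)⁻¹ *
                (((mu ν ε₀ t) ^ 2)⁻¹ *
                  (Real.log (r * lam ν ε₀ t + 2) / (r * lam ν ε₀ t + 1)))) := by
  refine ⟨1, one_pos, fun ε₀ _ => ⟨1 / 4, by norm_num,
    approxSol (ampl ((1 + ν) / 2) (ε₀ / 2)), ?_⟩⟩
  have hA := amp_ampl ((1 + ν) / 2) (ε₀ / 2)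
  have hp : 2 < (1 + ν) / 2 := by linarith
  have ho : IsOpen {x : ℝ × ℝ | x.1 < 1} := isOpen_lt continuous_fst continuous_const
  have cone := fun (k j : ℕ) (hkj : k + j ≤ 2) =>
    pd_bounds ν ε₀ hν (Ω := Amp.shortCone) (isOpen_lightCone.inter ho) subset_rfl hkj
      ((hA.symb_corrTwo_lightCone hp).mono_set fun x hx => hx.1)
  refine ⟨(hA.contDiffOn_approxSol hp).mono fun x hx => ⟨hx.1, hx.2.2.1⟩, ?_, fun k j => ?_,
    fun k j hkj => ?_⟩
  · obtain ⟨C, hC⟩ := cone 0 0 (by norm_num)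
    refine ⟨C, fun t r ht ht1 hr hrt => ?_⟩
    have h := hC t r ⟨⟨hr, hrt⟩, by simp only; linarith⟩
    simp only [pd_zero_zero, pow_zero, inv_one, mul_one] at h
    exact ⟨h.1.trans (le_of_eq (by ring)), h.2.trans (le_of_eq (by ring))⟩
  · obtain ⟨C, hC⟩ := pd_bounds ν ε₀ hν (Ω := innerCone ∩ {x | x.1 < 1})
      (isOpen_innerCone.inter ho) (fun x hx => ⟨innerCone_subset_lightCone hx.1, hx.2⟩)
      (le_refl (k + j)) ((hA.symb_corrTwo_inner hp _).mono_set inter_subset_left)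
    exact ⟨C, fun t r ht ht1 hr hrt => hC t r ⟨⟨hr, hrt⟩, by simp only [mem_ofPred_eq]; linarith⟩⟩
  · obtain ⟨C, hC⟩ := cone k j hkj
    exact ⟨C, fun t r ht ht1 hr hrt => hC t r ⟨⟨hr, hrt⟩, by simp only; linarith⟩⟩
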